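/- arXiv:1302.3773 — 5 statements merged into one kernel-verified Lean document; each statement's English description precedes it below -/
import Mathlib

section
/- Let I be an open interval of ℝ, ν a signed Radon measure on I, x₀ ∈ I and u₀, v₀ ∈ ℝ. Then there exists exactly one solution u of u″ + uν = 0 on I with u(x₀) = u₀ and right-derivative g(x₀) = v₀. Equivalently, there is exactly one continuous function u : I → ℝ satisfying, for every x ∈ I, u(x) = u₀ + (x − x₀)v₀ − ∫ |x − y| u(y) ν(dy), where the integral is taken over the half-open interval (x₀, x] when x ≥ x₀ and over (x, x₀] when x < x₀. -/
open MeasureTheory Set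

/-- `u` is a solution of `u'' + u ν = 0` on `I`, where the signed Radon measure `ν`
is represented as the difference `νp - νm` of two (locally finite on `I`) positive
Borel measures, and `g` is the right-continuous right-derivative of `u`. -/
def IsSolutionSM (I : Set ℝ) (νp νm : Measure ℝ) (u g : ℝ → ℝ) : Prop :=
  ContinuousOn u I ∧
  (∀ x ∈ I, ContinuousWithinAt g (Ici x) x) ∧
  (∀ x' ∈ I, ∀ x ∈ I, u x = u x' + ∫ t in x'..x, g t) ∧
  (∀ x' ∈ I, ∀ x ∈ I, x' ≤ x →
    g x - g x' = -((∫ t in Ioc x' x, u t ∂νp) - ∫ t in Ioc x' x, u t ∂νm))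

section Primitive

variable {μ : Measure ℝ} {a b c x y : ℝ} {w : ℝ → ℝ}

theorem intervalIntegrable_of_continuousOn_Icc (hμ : μ (Icc a b) < ⊤)
    (hw : ContinuousOn w (Icc a b)) (hx : x ∈ Icc a b) (hy : y ∈ Icc a b) :
    IntervalIntegrable w μ x y := by
  obtain ⟨C, hC⟩ := isCompact_Icc.exists_bound_of_continuousOn hw
  have h : IntegrableOn w (Icc a b) μ :=
    IntegrableOn.of_bound hμ (hw.aestronglyMeasurable measurableSet_Icc) C
      ((ae_restrict_iff' measurableSet_Icc).2 (ae_of_all _ hC))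
  exact (h.mono_set (ordConnected_Icc.uIcc_subset hx hy)).intervalIntegrable

theorem monotoneOn_primitive (hμ : μ (Icc a b) < ⊤) (hw : ContinuousOn w (Icc a b))
    (hw0 : ∀ t, 0 ≤ w t) (hc : c ∈ Icc a b) :
    MonotoneOn (fun t => ∫ y in c..t, w y ∂μ) (Icc a b) := by
  intro s hs t ht hst
  have h := intervalIntegral.integral_interval_sub_left
    (intervalIntegrable_of_continuousOn_Icc hμ hw hc ht)
    (intervalIntegrable_of_continuousOn_Icc hμ hw hc hs)
  have h' : 0 ≤ ∫ y in s..t, w y ∂μ := intervalIntegral.integral_nonneg hst fun u _ => hw0 u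
  simp only
  linarith

theorem intervalIntegrable_primitive (hμ : μ (Icc a b) < ⊤) (hw : ContinuousOn w (Icc a b))
    (hc : c ∈ Icc a b) (hx : x ∈ Icc a b) (hy : y ∈ Icc a b) :
    IntervalIntegrable (fun t => ∫ y in c..t, w y ∂μ) volume x y := by
  have hxy := ordConnected_Icc.uIcc_subset hx hy
  have hp : ContinuousOn (fun t => max (w t) 0) (Icc a b) := hw.sup continuousOn_const
  have hm : ContinuousOn (fun t => max (-w t) 0) (Icc a b) := hw.neg.sup continuousOn_const
  have h := ((monotoneOn_primitive hμ hp (fun _ => le_max_right _ _) hc).mono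
    hxy).intervalIntegrable (μ := volume) |>.sub
    ((monotoneOn_primitive hμ hm (fun _ => le_max_right _ _) hc).mono hxy).intervalIntegrable
  refine h.congr fun t ht => ?_
  have ht' := hxy (uIoc_subset_uIcc ht)
  rw [← intervalIntegral.integral_sub (intervalIntegrable_of_continuousOn_Icc hμ hp hc ht')
    (intervalIntegrable_of_continuousOn_Icc hμ hm hc ht')]
  refine intervalIntegral.integral_congr fun z _ => ?_
  rcases le_total (w z) 0 with h0 | h0
  · rw [max_eq_right h0, max_eq_left (by linarith)]; ring
  · rw [max_eq_left h0, max_eq_right (by linarith)]; ring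

theorem abs_primitive_le (hμ : μ (Icc a b) < ⊤) (hc : c ∈ Icc a b) (hx : x ∈ Icc a b)
    {K : ℝ} (hK : 0 ≤ K) {n : ℕ} (hw : ∀ t ∈ Icc a b, |w t| ≤ K * |t - c| ^ n) :
    |∫ y in c..x, w y ∂μ| ≤ K * |x - c| ^ n * μ.real (Icc a b) := by
  have hcx := ordConnected_Icc.uIcc_subset hc hx
  have hsub : uIoc c x ⊆ Icc a b := uIoc_subset_uIcc.trans hcx
  rw [← Real.norm_eq_abs, intervalIntegral.norm_integral_eq_norm_integral_uIoc]
  calc ‖∫ y in uIoc c x, w y ∂μ‖ ≤ K * |x - c| ^ n * μ.real (uIoc c x) := by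
        refine norm_setIntegral_le_of_norm_le_const ((measure_mono hsub).trans_lt hμ)
          fun t ht => (hw t (hsub ht)).trans ?_
        have : |t - c| ≤ |x - c| := abs_sub_left_of_mem_uIcc (uIoc_subset_uIcc ht)
        gcongr
    _ ≤ _ := by
        gcongr
        exact hμ.ne

theorem continuousWithinAt_Ici_primitive (hμ : μ (Icc a b) < ⊤) (hw : ContinuousOn w (Icc a b))
    (hc : c ∈ Icc a b) (hx : x ∈ Ico a b) :
    ContinuousWithinAt (fun t => ∫ y in c..t, w y ∂μ) (Ici x) x := by
  have hx' : x ∈ Icc a b := Ico_subset_Icc_self hx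
  have hb : b ∈ Icc a b := right_mem_Icc.2 (hx.1.trans hx.2.le)
  have h := intervalIntegral.continuousWithinAt_primitive (μ := μ.restrict (Ioi x)) (f := w)
    (a := x) (b₀ := x) (b₁ := x) (b₂ := b) (by simp) (by
      rw [min_self, max_eq_right hx.2.le]
      have := intervalIntegrable_of_continuousOn_Icc hμ hw hx' hb
      exact ⟨this.1.mono_measure Measure.restrict_le_self,
        this.2.mono_measure Measure.restrict_le_self⟩)
  have h2 : ContinuousWithinAt (fun t => (∫ y in c..x, w y ∂μ) +
      ∫ y in x..t, w y ∂(μ.restrict (Ioi x))) (Icc x b) x := continuousWithinAt_const.add h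
  have h3 : ContinuousWithinAt (fun t => ∫ y in c..t, w y ∂μ) (Icc x b) x := by
    refine h2.congr_of_mem (fun t ht => ?_) (left_mem_Icc.2 hx.2.le)
    have ht' : t ∈ Icc a b := ⟨hx.1.trans ht.1, ht.2⟩
    rw [← intervalIntegral.integral_add_adjacent_intervals
      (intervalIntegrable_of_continuousOn_Icc hμ hw hc hx')
      (intervalIntegrable_of_continuousOn_Icc hμ hw hx' ht'),
      intervalIntegral.integral_of_le ht.1, intervalIntegral.integral_of_le ht.1,
      Measure.restrict_restrict measurableSet_Ioc, inter_eq_left.2 Ioc_subset_Ioi_self]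
  exact h3.mono_of_mem_nhdsWithin (Icc_mem_nhdsGE hx.2)

end Primitive

/-- The integral of `w` over `(c, t]` (over `(t, c]`, with a minus sign, if `t < c`) against
`νp - νm`. -/
noncomputable def signedPrimitive (νp νm : Measure ℝ) (c : ℝ) (w : ℝ → ℝ) (t : ℝ) : ℝ :=
  (∫ y in c..t, w y ∂νp) - ∫ y in c..t, w y ∂νm

/-- The Volterra operator whose fixed points, up to an affine function, are the solutions of
`u'' + u ν = 0`. -/
noncomputable def volterra (νp νm : Measure ℝ) (c : ℝ) (w : ℝ → ℝ) (x : ℝ) : ℝ :=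
  -∫ t in c..x, signedPrimitive νp νm c w t

/-- Picard iterates of `u = u₀ + (x - c) v₀ + volterra u`, started from zero. -/
noncomputable def picard (νp νm : Measure ℝ) (c u₀ v₀ : ℝ) : ℕ → ℝ → ℝ
  | 0 => fun _ => 0
  | n + 1 => fun x => u₀ + (x - c) * v₀ + volterra νp νm c (picard νp νm c u₀ v₀ n) x

section Volterra

variable {νp νm : Measure ℝ} {a b c x y : ℝ} {w w' : ℝ → ℝ}

theorem intervalIntegrable_signedPrimitive (hp : νp (Icc a b) < ⊤) (hm : νm (Icc a b) < ⊤)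
    (hw : ContinuousOn w (Icc a b)) (hc : c ∈ Icc a b) (hx : x ∈ Icc a b) (hy : y ∈ Icc a b) :
    IntervalIntegrable (signedPrimitive νp νm c w) volume x y :=
  (intervalIntegrable_primitive hp hw hc hx hy).sub (intervalIntegrable_primitive hm hw hc hx hy)

theorem signedPrimitive_sub_signedPrimitive (hp : νp (Icc a b) < ⊤) (hm : νm (Icc a b) < ⊤)
    (hw : ContinuousOn w (Icc a b)) (hc : c ∈ Icc a b) (hx : x ∈ Icc a b) (hy : y ∈ Icc a b) :
    signedPrimitive νp νm c w y - signedPrimitive νp νm c w x =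
      signedPrimitive νp νm x w y := by
  have h1 := intervalIntegral.integral_interval_sub_left
    (intervalIntegrable_of_continuousOn_Icc hp hw hc hy)
    (intervalIntegrable_of_continuousOn_Icc hp hw hc hx)
  have h2 := intervalIntegral.integral_interval_sub_left
    (intervalIntegrable_of_continuousOn_Icc hm hw hc hy)
    (intervalIntegrable_of_continuousOn_Icc hm hw hc hx)
  simp only [signedPrimitive]
  linarith

theorem volterra_sub (hp : νp (Icc a b) < ⊤) (hm : νm (Icc a b) < ⊤)
    (hw : ContinuousOn w (Icc a b)) (hw' : ContinuousOn w' (Icc a b)) (hc : c ∈ Icc a b)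
    (hx : x ∈ Icc a b) :
    volterra νp νm c (fun t => w t - w' t) x = volterra νp νm c w x - volterra νp νm c w' x := by
  have h : ∫ t in c..x, signedPrimitive νp νm c (fun t => w t - w' t) t =
      ∫ t in c..x, (signedPrimitive νp νm c w t - signedPrimitive νp νm c w' t) := by
    refine intervalIntegral.integral_congr fun t ht => ?_
    have ht' := ordConnected_Icc.uIcc_subset hc hx ht
    simp only [signedPrimitive]
    rw [intervalIntegral.integral_sub (intervalIntegrable_of_continuousOn_Icc hp hw hc ht')
      (intervalIntegrable_of_continuousOn_Icc hp hw' hc ht'),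
      intervalIntegral.integral_sub (intervalIntegrable_of_continuousOn_Icc hm hw hc ht')
      (intervalIntegrable_of_continuousOn_Icc hm hw' hc ht')]
    ring
  rw [volterra, h, intervalIntegral.integral_sub
    (intervalIntegrable_signedPrimitive hp hm hw hc hc hx)
    (intervalIntegrable_signedPrimitive hp hm hw' hc hc hx), volterra, volterra]
  ring

theorem continuousOn_volterra (hp : νp (Icc a b) < ⊤) (hm : νm (Icc a b) < ⊤)
    (hw : ContinuousOn w (Icc a b)) (hc : c ∈ Icc a b) :
    ContinuousOn (volterra νp νm c w) (Icc a b) := by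
  have hab : a ≤ b := hc.1.trans hc.2
  have h := intervalIntegral.continuousOn_primitive_interval' (a := c)
    (intervalIntegrable_signedPrimitive hp hm hw hc (left_mem_Icc.2 hab) (right_mem_Icc.2 hab))
    (by rwa [uIcc_of_le hab])
  rw [uIcc_of_le hab] at h
  exact h.neg

theorem abs_volterra_le (hp : νp (Icc a b) < ⊤) (hm : νm (Icc a b) < ⊤)
    (hc : c ∈ Icc a b) (hx : x ∈ Icc a b)
    {K : ℝ} (hK : 0 ≤ K) {n : ℕ} (hw : ∀ t ∈ Icc a b, |w t| ≤ K * |t - c| ^ n) :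
    |volterra νp νm c w x| ≤
      K * (νp.real (Icc a b) + νm.real (Icc a b)) / (n + 1) * |x - c| ^ (n + 1) := by
  set M := νp.real (Icc a b) + νm.real (Icc a b)
  have hsub : uIoc c x ⊆ Icc a b :=
    uIoc_subset_uIcc.trans (ordConnected_Icc.uIcc_subset hc hx)
  rw [volterra, abs_neg, ← Real.norm_eq_abs,
    intervalIntegral.norm_integral_eq_norm_integral_uIoc]
  calc ‖∫ t in uIoc c x, signedPrimitive νp νm c w t‖
      ≤ ∫ t in uIoc c x, K * M * |t - c| ^ n := by
        refine norm_integral_le_of_norm_le ?_ ?_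
        · exact (Continuous.integrableOn_uIoc (by fun_prop))
        · refine (ae_restrict_iff' measurableSet_uIoc).2 (ae_of_all _ fun t ht => ?_)
          have h1 := abs_primitive_le hp hc (hsub ht) hK hw
          have h2 := abs_primitive_le hm hc (hsub ht) hK hw
          calc ‖signedPrimitive νp νm c w t‖ ≤ _ := abs_sub _ _
            _ ≤ _ := add_le_add h1 h2
            _ = _ := by ring
    _ = _ := by
        rw [integral_const_mul, integral_pow_abs_sub_uIoc]
        ring

theorem abs_le_of_volterra_iterates (hp : νp (Icc a b) < ⊤) (hm : νm (Icc a b) < ⊤)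
    (hc : c ∈ Icc a b) {f : ℕ → ℝ → ℝ} {C : ℝ} (hC : ∀ t ∈ Icc a b, |f 0 t| ≤ C)
    (hf : ∀ n, ∀ t ∈ Icc a b, f (n + 1) t = volterra νp νm c (f n) t) (n : ℕ) :
    ∀ t ∈ Icc a b, |f n t| ≤
      C * (νp.real (Icc a b) + νm.real (Icc a b)) ^ n / n.factorial * |t - c| ^ n := by
  have hC0 : 0 ≤ C := (abs_nonneg _).trans (hC c hc)
  induction n with
  | zero => simpa using hC
  | succ n ih =>
    intro t ht
    rw [hf n t ht]
    refine (abs_volterra_le hp hm hc ht (by positivity) ih).trans_eq ?_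
    rw [Nat.factorial_succ]
    push_cast
    field_simp
    ring

theorem eqOn_zero_of_eq_volterra (hp : νp (Icc a b) < ⊤) (hm : νm (Icc a b) < ⊤)
    (hc : c ∈ Icc a b) (hw : ContinuousOn w (Icc a b))
    (h : ∀ t ∈ Icc a b, w t = volterra νp νm c w t) (hx : x ∈ Icc a b) : w x = 0 := by
  obtain ⟨C, hC⟩ := isCompact_Icc.exists_bound_of_continuousOn hw
  have hb := fun n => abs_le_of_volterra_iterates hp hm hc (f := fun _ => w) hC
    (fun _ => h) n x hx
  have hlim := (FloorSemiring.tendsto_pow_div_factorial_atTop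
    ((νp.real (Icc a b) + νm.real (Icc a b)) * |x - c|)).const_mul C
  rw [mul_zero] at hlim
  refine abs_nonpos_iff.1 (ge_of_tendsto' hlim fun n => (hb n).trans_eq ?_)
  rw [mul_pow]
  ring

variable {u₀ v₀ : ℝ}

theorem continuousOn_picard (hp : νp (Icc a b) < ⊤) (hm : νm (Icc a b) < ⊤)
    (hc : c ∈ Icc a b) (n : ℕ) : ContinuousOn (picard νp νm c u₀ v₀ n) (Icc a b) := by
  induction n with
  | zero => exact continuousOn_const
  | succ n ih =>
    exact ContinuousOn.add (by fun_prop) (continuousOn_volterra hp hm ih hc)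

/-- The limit of the Picard iterates. -/
noncomputable def picardLimit (νp νm : Measure ℝ) (c u₀ v₀ x : ℝ) : ℝ :=
  ∑' n, (picard νp νm c u₀ v₀ (n + 1) x - picard νp νm c u₀ v₀ n x)

theorem tendstoUniformlyOn_picard (hp : νp (Icc a b) < ⊤) (hm : νm (Icc a b) < ⊤)
    (hc : c ∈ Icc a b) :
    TendstoUniformlyOn (picard νp νm c u₀ v₀) (picardLimit νp νm c u₀ v₀) Filter.atTop
      (Icc a b) := by
  set f : ℕ → ℝ → ℝ := fun n x => picard νp νm c u₀ v₀ (n + 1) x - picard νp νm c u₀ v₀ n x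
  have hcont := fun n => continuousOn_picard (u₀ := u₀) (v₀ := v₀) hp hm hc n
  obtain ⟨C, hC⟩ := isCompact_Icc.exists_bound_of_continuousOn ((hcont 1).sub (hcont 0))
  have hC0 : 0 ≤ C := (norm_nonneg _).trans (hC c hc)
  have hb := abs_le_of_volterra_iterates hp hm hc (f := f) hC fun n t ht => by
    rw [volterra_sub hp hm (hcont (n + 1)) (hcont n) hc ht]
    simp only [f, picard]
    ring
  have hsum := (Real.summable_pow_div_factorial
    ((νp.real (Icc a b) + νm.real (Icc a b)) * (b - a))).mul_left C
  have h := tendstoUniformlyOn_tsum_nat (f := f) (s := Icc a b) hsum fun n t ht => by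
    refine (hb n t ht).trans ?_
    have : |t - c| ≤ b - a := abs_sub_le_iff.2 ⟨by linarith [ht.2, hc.1], by linarith [ht.1, hc.2]⟩
    have h2 : |t - c| ^ n ≤ (b - a) ^ n := by gcongr
    calc _ ≤ C * ((νp.real (Icc a b) + νm.real (Icc a b)) ^ n / n.factorial * (b - a) ^ n) := by
          rw [mul_div_assoc, mul_assoc]
          gcongr
      _ = _ := by rw [mul_pow]; ring
  refine h.congr (Filter.Eventually.of_forall fun N x _ => ?_)
  simp only [f]
  rw [Finset.sum_range_sub (fun n => picard νp νm c u₀ v₀ n x)]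
  simp [picard]

theorem continuousOn_picardLimit (hp : νp (Icc a b) < ⊤) (hm : νm (Icc a b) < ⊤)
    (hc : c ∈ Icc a b) : ContinuousOn (picardLimit νp νm c u₀ v₀) (Icc a b) :=
  (tendstoUniformlyOn_picard hp hm hc).continuousOn
    (Filter.Frequently.of_forall fun n => continuousOn_picard hp hm hc n)

theorem picardLimit_eq (hp : νp (Icc a b) < ⊤) (hm : νm (Icc a b) < ⊤)
    (hc : c ∈ Icc a b) (hx : x ∈ Icc a b) :
    picardLimit νp νm c u₀ v₀ x =
      u₀ + (x - c) * v₀ + volterra νp νm c (picardLimit νp νm c u₀ v₀) x := by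
  have hunif := tendstoUniformlyOn_picard (u₀ := u₀) (v₀ := v₀) hp hm hc
  have hlim := (Filter.tendsto_add_atTop_iff_nat 1).2 (hunif.tendsto_at hx)
  refine tendsto_nhds_unique hlim (Filter.Tendsto.const_add _ ?_)
  set L := (νp.real (Icc a b) + νm.real (Icc a b)) * |x - c|
  have hL : 0 ≤ L := by positivity
  refine Metric.tendsto_atTop.2 fun ε hε => ?_
  obtain ⟨N, hN⟩ := Filter.eventually_atTop.1
    (Metric.tendstoUniformlyOn_iff.1 hunif (ε / (L + 1)) (by positivity))
  refine ⟨N, fun n hn => ?_⟩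
  rw [dist_comm, Real.dist_eq, ← volterra_sub hp hm (continuousOn_picardLimit hp hm hc)
    (continuousOn_picard hp hm hc n) hc hx]
  have hle := abs_volterra_le hp hm hc hx (K := ε / (L + 1)) (n := 0) (by positivity)
    (w := fun t => picardLimit νp νm c u₀ v₀ t - picard νp νm c u₀ v₀ n t)
    fun t ht => by simpa [Real.dist_eq] using (hN n hn t ht).le
  refine hle.trans_lt ?_
  calc _ = ε * (L / (L + 1)) := by simp only [L]; push_cast; ring
    _ < ε * 1 := by
        gcongr
        exact (div_lt_one (by positivity)).2 (by linarith)
    _ = ε := mul_one ε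

end Volterra

theorem IsSolutionSM.eq_add_volterra {I : Set ℝ} {νp νm : Measure ℝ} {u g : ℝ → ℝ}
    (h : IsSolutionSM I νp νm u g) {a b c x : ℝ} (hI : Icc a b ⊆ I)
    (hp : νp (Icc a b) < ⊤) (hm : νm (Icc a b) < ⊤) (hc : c ∈ Icc a b) (hx : x ∈ Icc a b) :
    u x = u c + (x - c) * g c + volterra νp νm c u x := by
  obtain ⟨hu, -, hug, hg⟩ := h
  have hgt : ∀ t ∈ Icc a b, g t = g c - signedPrimitive νp νm c u t := by
    intro t ht
    rcases le_total c t with hct | hct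
    · have := hg c (hI hc) t (hI ht) hct
      rw [signedPrimitive, intervalIntegral.integral_of_le hct,
        intervalIntegral.integral_of_le hct]
      linarith
    · have := hg t (hI ht) c (hI hc) hct
      rw [signedPrimitive, intervalIntegral.integral_of_ge hct,
        intervalIntegral.integral_of_ge hct]
      linarith
  rw [hug c (hI hc) x (hI hx), intervalIntegral.integral_congr
    fun t ht => hgt t (ordConnected_Icc.uIcc_subset hc hx ht),
    intervalIntegral.integral_sub intervalIntegrable_const
      (intervalIntegrable_signedPrimitive hp hm (hu.mono hI) hc hc hx),
    intervalIntegral.integral_const, volterra, smul_eq_mul]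
  ring

theorem exists_Icc_subset_of_mem_isOpen {I : Set ℝ} (hI : IsOpen I) [I.OrdConnected]
    {c x y : ℝ} (hc : c ∈ I) (hx : x ∈ I) (hy : y ∈ I) :
    ∃ a ∈ I, ∃ b ∈ I, Icc a b ⊆ I ∧ c ∈ Icc a b ∧ x ∈ Ioo a b ∧ y ∈ Icc a b := by
  obtain ⟨l, r, hlr, hsub⟩ := mem_nhds_iff_exists_Ioo_subset.1 (hI.mem_nhds hx)
  obtain ⟨a', ha'⟩ := exists_between hlr.1
  obtain ⟨b', hb'⟩ := exists_between hlr.2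
  have ha : min a' (min c y) ∈ I := by
    rcases min_choice a' (min c y) with h | h
    · rw [h]
      exact hsub ⟨ha'.1, ha'.2.trans hlr.2⟩
    · rcases min_choice c y with h' | h' <;> rw [h, h'] <;> assumption
  have hb : max b' (max c y) ∈ I := by
    rcases max_choice b' (max c y) with h | h
    · rw [h]
      exact hsub ⟨hlr.1.trans hb'.1, hb'.2⟩
    · rcases max_choice c y with h' | h' <;> rw [h, h'] <;> assumption
  exact ⟨_, ha, _, hb, OrdConnected.out ‹_› ha hb, by simp, by simp [ha'.2, hb'.1], by simp⟩

theorem isSolutionSM_picardLimit {I : Set ℝ} (hIopen : IsOpen I) [I.OrdConnected]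
    {νp νm : Measure ℝ} (hνp : ∀ x ∈ I, ∀ y ∈ I, νp (Icc x y) < ⊤)
    (hνm : ∀ x ∈ I, ∀ y ∈ I, νm (Icc x y) < ⊤) {c : ℝ} (hc : c ∈ I) (u₀ v₀ : ℝ) :
    IsSolutionSM I νp νm (picardLimit νp νm c u₀ v₀)
      (fun t => v₀ - signedPrimitive νp νm c (picardLimit νp νm c u₀ v₀) t) := by
  refine ⟨fun x hx => ?_, fun x hx => ?_, fun x' hx' x hx => ?_, fun x' hx' x hx hle => ?_⟩
  · obtain ⟨a, ha, b, hb, -, hc', hx', -⟩ := exists_Icc_subset_of_mem_isOpen hIopen hc hx hx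
    exact ((continuousOn_picardLimit (hνp a ha b hb) (hνm a ha b hb) hc').continuousAt
      (Icc_mem_nhds hx'.1 hx'.2)).continuousWithinAt
  · obtain ⟨a, ha, b, hb, -, hc', hx', -⟩ := exists_Icc_subset_of_mem_isOpen hIopen hc hx hx
    have hp := hνp a ha b hb
    have hm := hνm a ha b hb
    have hcont := continuousOn_picardLimit (u₀ := u₀) (v₀ := v₀) hp hm hc'
    exact continuousWithinAt_const.sub
      ((continuousWithinAt_Ici_primitive hp hcont hc' (Ioo_subset_Ico_self hx')).sub
        (continuousWithinAt_Ici_primitive hm hcont hc' (Ioo_subset_Ico_self hx')))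
  · obtain ⟨a, ha, b, hb, -, hc', hxx, hxx'⟩ :=
      exists_Icc_subset_of_mem_isOpen hIopen hc hx hx'
    have hxx := Ioo_subset_Icc_self hxx
    have hp := hνp a ha b hb
    have hm := hνm a ha b hb
    have hcont := continuousOn_picardLimit (u₀ := u₀) (v₀ := v₀) hp hm hc'
    have hi := fun {y z : ℝ} (hy : y ∈ Icc a b) (hz : z ∈ Icc a b) =>
      intervalIntegrable_signedPrimitive hp hm hcont hc' hy hz
    have hadj := intervalIntegral.integral_interval_sub_left (hi hc' hxx) (hi hc' hxx')
    rw [picardLimit_eq hp hm hc' hxx, picardLimit_eq hp hm hc' hxx',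
      intervalIntegral.integral_sub intervalIntegrable_const (hi hxx' hxx),
      intervalIntegral.integral_const, ← hadj, volterra, volterra, smul_eq_mul]
    ring
  · obtain ⟨a, ha, b, hb, -, hc', hxx, hxx'⟩ :=
      exists_Icc_subset_of_mem_isOpen hIopen hc hx hx'
    have hp := hνp a ha b hb
    have hm := hνm a ha b hb
    have h := signedPrimitive_sub_signedPrimitive hp hm
      (continuousOn_picardLimit (u₀ := u₀) (v₀ := v₀) hp hm hc') hc' hxx' (Ioo_subset_Icc_self hxx)
    rw [← intervalIntegral.integral_of_le hle, ← intervalIntegral.integral_of_le hle]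
    change _ = -signedPrimitive νp νm x' _ x
    rw [← h]
    ring

/-- existence and uniqueness of the solution of `u'' + u ν = 0` on `I`
with prescribed value and right-derivative at `x₀ ∈ I`. -/
theorem existsUnique_solution_of_initial_conditions
    (I : Set ℝ) (hIopen : IsOpen I) (hIconn : I.OrdConnected)
    (νp νm : Measure ℝ)
    (hνp : ∀ x ∈ I, ∀ y ∈ I, νp (Icc x y) < ⊤)
    (hνm : ∀ x ∈ I, ∀ y ∈ I, νm (Icc x y) < ⊤)
    (x₀ : ℝ) (hx₀ : x₀ ∈ I) (u₀ v₀ : ℝ) :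
    (∃ u g : ℝ → ℝ, IsSolutionSM I νp νm u g ∧ u x₀ = u₀ ∧ g x₀ = v₀) ∧
      ∀ u₁ g₁ u₂ g₂ : ℝ → ℝ,
        IsSolutionSM I νp νm u₁ g₁ → u₁ x₀ = u₀ → g₁ x₀ = v₀ →
        IsSolutionSM I νp νm u₂ g₂ → u₂ x₀ = u₀ → g₂ x₀ = v₀ →
        EqOn u₁ u₂ I := by
  refine ⟨⟨_, _, isSolutionSM_picardLimit hIopen hνp hνm hx₀ u₀ v₀, ?_, ?_⟩, ?_⟩
  · have hmem : x₀ ∈ Icc x₀ x₀ := left_mem_Icc.2 le_rfl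
    rw [picardLimit_eq (hνp x₀ hx₀ x₀ hx₀) (hνm x₀ hx₀ x₀ hx₀) hmem hmem]
    simp [volterra]
  · simp [signedPrimitive]
  · intro u₁ g₁ u₂ g₂ h₁ hu₁ hg₁ h₂ hu₂ hg₂ x hx
    obtain ⟨a, ha, b, hb, hsub, hc, hxm, -⟩ := exists_Icc_subset_of_mem_isOpen hIopen hx₀ hx hx
    have hp := hνp a ha b hb
    have hm := hνm a ha b hb
    have hc₁ := h₁.1.mono hsub
    have hc₂ := h₂.1.mono hsub
    refine sub_eq_zero.1 (eqOn_zero_of_eq_volterra (w := fun t => u₁ t - u₂ t) hp hm hc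
      (hc₁.sub hc₂) (fun t ht => ?_) (Ioo_subset_Icc_self hxm))
    rw [volterra_sub hp hm hc₁ hc₂ hc ht, h₁.eq_add_volterra hsub hp hm hc ht,
      h₂.eq_add_volterra hsub hp hm hc ht, hu₁, hu₂, hg₁, hg₂]
    ring
end

section
/- Let I be an open interval of ℝ and ν a signed Radon measure on I. If u₁ and u₂ are two solutions of u″ + uν = 0 on I, with right-derivatives g₁ and g₂, then the Wronskian W(u₁,u₂)(x) := u₁(x)·g₂(x) − u₂(x)·g₁(x) is constant on I. -/
open MeasureTheory Set

/-- A function whose increments are controlled by `(b - a) * (F b - F a)` takes the same value at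
both ends of the interval. -/
theorem eq_of_abs_sub_le_mul_mul {W F : ℝ → ℝ} {x y C : ℝ} (hxy : x ≤ y)
    (h : ∀ a b, x ≤ a → a ≤ b → b ≤ y → |W b - W a| ≤ C * (b - a) * (F b - F a)) :
    W x = W y := by
  have key : ∀ n : ℕ, |W y - W x| ≤ C * ((y - x) / (n + 1 : ℝ)) * (F y - F x) := by
    intro n
    have hn : (0 : ℝ) < n + 1 := by positivity
    set d : ℝ := (y - x) / (n + 1 : ℝ) with hd
    have hd0 : 0 ≤ d := div_nonneg (by linarith) hn.le
    have hdn : (n + 1 : ℝ) * d = y - x := by rw [hd]; field_simp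
    have step : ∀ k : ℕ, k ≤ n + 1 →
        |W (x + k * d) - W x| ≤ C * d * (F (x + k * d) - F x) := by
      intro k
      induction k with
      | zero => simp
      | succ k ih =>
        intro hk
        have hk' : ((k + 1 : ℕ) : ℝ) ≤ n + 1 := by exact_mod_cast hk
        have hle : ((k + 1 : ℕ) : ℝ) * d ≤ y - x := by
          rw [← hdn]
          exact mul_le_mul_of_nonneg_right hk' hd0
        have hkd : 0 ≤ (k : ℝ) * d := by positivity
        have heq : x + ((k + 1 : ℕ) : ℝ) * d - (x + k * d) = d := by push_cast; ring
        have h₁ := h (x + k * d) (x + ((k + 1 : ℕ) : ℝ) * d) (by linarith) (by linarith)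
          (by linarith)
        rw [heq] at h₁
        have h₂ := ih (by omega)
        have h₃ := abs_sub_le (W (x + ((k + 1 : ℕ) : ℝ) * d)) (W (x + k * d)) (W x)
        linarith
    have hfin := step (n + 1) le_rfl
    have hy : x + ((n + 1 : ℕ) : ℝ) * d = y := by push_cast; linarith
    rwa [hy] at hfin
  have hlim : Filter.Tendsto (fun n : ℕ => C * ((y - x) / (n + 1 : ℝ)) * (F y - F x))
      Filter.atTop (nhds 0) := by
    have h₀ := (tendsto_one_div_add_atTop_nhds_zero_nat (𝕜 := ℝ)).const_mul
      (C * (y - x) * (F y - F x))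
    rw [mul_zero] at h₀
    exact h₀.congr fun n => by ring
  have h₀ : |W y - W x| ≤ 0 := ge_of_tendsto' hlim key
  linarith [abs_nonpos_iff.mp h₀]

/-- The increment of `t ↦ ν (x, t]` over `[a, b]` is `ν (a, b]`. -/
theorem measureReal_Ioc_sub {ν : Measure ℝ} {x y a b : ℝ} (hν : ν (Icc x y) < ⊤)
    (hxa : x ≤ a) (hab : a ≤ b) (hby : b ≤ y) :
    ν.real (Ioc x b) - ν.real (Ioc x a) = ν.real (Ioc a b) := by
  have hfin : ∀ {c d : ℝ}, x ≤ c → d ≤ y → ν (Ioc c d) ≠ ⊤ := fun hc hd =>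
    ((measure_mono (Ioc_subset_Icc_self.trans (Icc_subset_Icc hc hd))).trans_lt hν).ne
  rw [← Ioc_union_Ioc_eq_Ioc hxa hab,
    measureReal_union (Ioc_disjoint_Ioc_of_le le_rfl) measurableSet_Ioc
      (hfin le_rfl (hab.trans hby)) (hfin hxa hby)]
  ring

theorem abs_setIntegral_sub_setIntegral_le {νp νm : Measure ℝ} {s : Set ℝ} {f : ℝ → ℝ} {C : ℝ}
    (hp : νp s < ⊤) (hm : νm s < ⊤) (hf : ∀ t ∈ s, |f t| ≤ C) :
    |(∫ t in s, f t ∂νp) - ∫ t in s, f t ∂νm| ≤ C * (νp.real s + νm.real s) := by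
  have h₁ := norm_setIntegral_le_of_norm_le_const (f := f) hp hf
  have h₂ := norm_setIntegral_le_of_norm_le_const (f := f) hm hf
  rw [Real.norm_eq_abs] at h₁ h₂
  linarith [abs_sub (∫ t in s, f t ∂νp) (∫ t in s, f t ∂νm)]

theorem IsSolutionSM.exists_bound {I : Set ℝ} (hI : I.OrdConnected) {νp νm : Measure ℝ}
    {u g : ℝ → ℝ} (h : IsSolutionSM I νp νm u g) {x y : ℝ} (hx : x ∈ I) (hy : y ∈ I)
    (hp : νp (Icc x y) < ⊤) (hm : νm (Icc x y) < ⊤) :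
    ∃ K, 0 ≤ K ∧ (∀ t ∈ Icc x y, |u t| ≤ K ∧ |g t| ≤ K) ∧
      ∀ a b, x ≤ a → a ≤ b → b ≤ y →
        |g b - g a| ≤ K * (νp.real (Ioc a b) + νm.real (Ioc a b)) ∧
        |u b - u a| ≤ K * (b - a) ∧ IntervalIntegrable g volume a b := by
  obtain ⟨hu, -, hug, hg⟩ := h
  have hsub : Icc x y ⊆ I := hI.out hx hy
  obtain ⟨M, hM⟩ := isCompact_Icc.exists_bound_of_continuousOn (hu.mono hsub)
  set F : ℝ → ℝ := fun t => νp.real (Ioc x t) + νm.real (Ioc x t) with hF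
  have hFsub : ∀ a b, x ≤ a → a ≤ b → b ≤ y →
      νp.real (Ioc a b) + νm.real (Ioc a b) = F b - F a := by
    intro a b hxa hab hby
    rw [← measureReal_Ioc_sub hp hxa hab hby, ← measureReal_Ioc_sub hm hxa hab hby]
    simp only [hF]
    ring
  have hginc : ∀ a b, x ≤ a → a ≤ b → b ≤ y → |g b - g a| ≤ M * (F b - F a) := by
    intro a b hxa hab hby
    have hs : Ioc a b ⊆ Icc x y := Ioc_subset_Icc_self.trans (Icc_subset_Icc hxa hby)
    rw [hg a (hsub ⟨hxa, hab.trans hby⟩) b (hsub ⟨hxa.trans hab, hby⟩) hab, abs_neg,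
      ← hFsub a b hxa hab hby]
    exact abs_setIntegral_sub_setIntegral_le ((measure_mono hs).trans_lt hp)
      ((measure_mono hs).trans_lt hm) fun t ht => hM t (hs ht)
  have hFmono : MonotoneOn F (Icc x y) := by
    intro a ha b hb hab
    have := hFsub a b ha.1 hab hb.2
    have : 0 ≤ νp.real (Ioc a b) + νm.real (Ioc a b) := by positivity
    linarith
  have hGmono : MonotoneOn (fun t => g t + M * F t) (Icc x y) := by
    intro a ha b hb hab
    have := (abs_le.mp (hginc a b ha.1 hab hb.2)).1
    simp only
    linarith
  have hint : ∀ a b, x ≤ a → a ≤ b → b ≤ y → IntervalIntegrable g volume a b := by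
    intro a b hxa hab hby
    have hs : uIcc a b ⊆ Icc x y := by
      rw [uIcc_of_le hab]
      exact Icc_subset_Icc hxa hby
    have h₁ := (hGmono.mono hs).intervalIntegrable (μ := volume)
    have h₂ := ((hFmono.mono hs).intervalIntegrable (μ := volume)).const_mul M
    refine (h₁.sub h₂).congr fun t _ => ?_
    simp
  have hM₀ : M ≤ |M| := le_abs_self M
  set N : ℝ := |g x| + |M| * |F y - F x| with hN
  have hN₀ : 0 ≤ N := by positivity
  have hgN : ∀ t ∈ Icc x y, |g t| ≤ N := by
    intro t ht
    have h₁ := hginc x t le_rfl ht.1 ht.2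
    have h₂ : F t ≤ F y := hFmono ht ⟨ht.1.trans ht.2, le_rfl⟩ ht.2
    have h₃ : F x ≤ F t := hFmono ⟨le_rfl, ht.1.trans ht.2⟩ ht ht.1
    have h₄ : M * (F t - F x) ≤ |M| * |F y - F x| :=
      mul_le_mul hM₀ ((sub_le_sub_right h₂ _).trans (le_abs_self _)) (by linarith) (abs_nonneg _)
    have h₅ := abs_add_le (g t - g x) (g x)
    rw [sub_add_cancel] at h₅
    linarith
  refine ⟨|M| + N, by positivity, fun t ht => ⟨?_, ?_⟩, fun a b hxa hab hby => ⟨?_, ?_, ?_⟩⟩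
  · have := hM t ht
    rw [Real.norm_eq_abs] at this
    linarith
  · linarith [hgN t ht, abs_nonneg M]
  · rw [hFsub a b hxa hab hby]
    refine (hginc a b hxa hab hby).trans (mul_le_mul_of_nonneg_right (by linarith) ?_)
    rw [← hFsub a b hxa hab hby]
    positivity
  · have haI := hsub ⟨hxa, hab.trans hby⟩
    have hbI := hsub ⟨hxa.trans hab, hby⟩
    have h₁ : ‖∫ t in a..b, g t‖ ≤ N * |b - a| :=
      intervalIntegral.norm_integral_le_of_norm_le_const fun t ht => by
        rw [uIoc_of_le hab] at ht
        exact hgN t ⟨hxa.trans ht.1.le, ht.2.trans hby⟩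
    rw [abs_of_nonneg (sub_nonneg.mpr hab), Real.norm_eq_abs] at h₁
    rw [hug a haI b hbI, add_sub_cancel_left]
    exact h₁.trans (mul_le_mul_of_nonneg_right (by linarith [abs_nonneg M]) (by linarith))
  · exact hint a b hxa hab hby

theorem ContinuousOn.integrableOn_Ioc_of_measure_Icc_lt_top {ν : Measure ℝ} {u : ℝ → ℝ} {a b : ℝ}
    (hu : ContinuousOn u (Icc a b)) (hν : ν (Icc a b) < ⊤) : IntegrableOn u (Ioc a b) ν := by
  obtain ⟨M, hM⟩ := isCompact_Icc.exists_bound_of_continuousOn hu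
  have hint : IntegrableOn u (Icc a b) ν :=
    IntegrableOn.of_bound hν (hu.aestronglyMeasurable measurableSet_Icc) M
      (ae_restrict_of_forall_mem measurableSet_Icc hM)
  exact hint.mono_set Ioc_subset_Icc_self

theorem abs_mul_sub_mul_le {p q r s A B : ℝ} (hA : 0 ≤ A) (hp : |p| ≤ A) (hr : |r| ≤ A)
    (hq : |q| ≤ B) (hs : |s| ≤ B) : |p * q - r * s| ≤ 2 * A * B := by
  have h₁ : |p * q| ≤ A * B := by
    rw [abs_mul]; exact mul_le_mul hp hq (abs_nonneg _) hA
  have h₂ : |r * s| ≤ A * B := by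
    rw [abs_mul]; exact mul_le_mul hr hs (abs_nonneg _) hA
  linarith [abs_sub (p * q) (r * s)]

theorem IsSolutionSM.wronskian_eq_of_le {I : Set ℝ} (hI : I.OrdConnected) {νp νm : Measure ℝ}
    {u₁ g₁ u₂ g₂ : ℝ → ℝ} (h₁ : IsSolutionSM I νp νm u₁ g₁) (h₂ : IsSolutionSM I νp νm u₂ g₂)
    {x y : ℝ} (hx : x ∈ I) (hy : y ∈ I) (hxy : x ≤ y)
    (hp : νp (Icc x y) < ⊤) (hm : νm (Icc x y) < ⊤) :
    u₁ x * g₂ x - u₂ x * g₁ x = u₁ y * g₂ y - u₂ y * g₁ y := by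
  obtain ⟨K₁, hK₁, hb₁, hi₁⟩ := h₁.exists_bound hI hx hy hp hm
  obtain ⟨K₂, hK₂, hb₂, hi₂⟩ := h₂.exists_bound hI hx hy hp hm
  obtain ⟨hu₁, -, hug₁, hg₁⟩ := h₁
  obtain ⟨hu₂, -, hug₂, hg₂⟩ := h₂
  have hsub : Icc x y ⊆ I := hI.out hx hy
  set K := max K₁ K₂
  have hK₁K : K₁ ≤ K := le_max_left _ _
  have hK₂K : K₂ ≤ K := le_max_right _ _
  have hK : 0 ≤ K := hK₁.trans hK₁K
  refine eq_of_abs_sub_le_mul_mul (W := fun t => u₁ t * g₂ t - u₂ t * g₁ t)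
    (F := fun t => νp.real (Ioc x t) + νm.real (Ioc x t)) (C := 4 * K * K) hxy ?_
  intro a b hxa hab hby
  have ha : a ∈ Icc x y := ⟨hxa, hab.trans hby⟩
  have hb : b ∈ Icc x y := ⟨hxa.trans hab, hby⟩
  have hs : Icc a b ⊆ Icc x y := Icc_subset_Icc hxa hby
  have hpab : νp (Icc a b) < ⊤ := (measure_mono hs).trans_lt hp
  have hmab : νm (Icc a b) < ⊤ := (measure_mono hs).trans_lt hm
  set φ := νp.real (Ioc a b) + νm.real (Ioc a b) with hφ
  have hφ₀ : 0 ≤ φ := by positivity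
  have hFφ : νp.real (Ioc x b) + νm.real (Ioc x b) - (νp.real (Ioc x a) + νm.real (Ioc x a))
      = φ := by
    rw [hφ, ← measureReal_Ioc_sub hp hxa hab hby, ← measureReal_Ioc_sub hm hxa hab hby]
    ring
  have hcomb : ∀ ν : Measure ℝ, ν (Icc a b) < ⊤ →
      ∫ t in Ioc a b, (u₁ b * u₂ t - u₂ b * u₁ t) ∂ν
        = u₁ b * (∫ t in Ioc a b, u₂ t ∂ν) - u₂ b * ∫ t in Ioc a b, u₁ t ∂ν := by
    intro ν hν
    have i₁ := (hu₁.mono (hs.trans hsub)).integrableOn_Ioc_of_measure_Icc_lt_top hν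
    have i₂ := (hu₂.mono (hs.trans hsub)).integrableOn_Ioc_of_measure_Icc_lt_top hν
    rw [integral_sub (i₂.const_mul _) (i₁.const_mul _), integral_const_mul, integral_const_mul]
  have hν : |u₁ b * (g₂ b - g₂ a) - u₂ b * (g₁ b - g₁ a)| ≤ 2 * K * (K * (b - a)) * φ := by
    have hbd : ∀ t ∈ Ioc a b, |u₁ b * u₂ t - u₂ b * u₁ t| ≤ 2 * K * (K * (b - a)) := by
      intro t ht
      have e : u₁ b * u₂ t - u₂ b * u₁ t
          = u₂ b * (u₁ b - u₁ t) - u₁ b * (u₂ b - u₂ t) := by ring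
      rw [e]
      have hlen : b - t ≤ b - a := by linarith [ht.1]
      have hlen₀ : 0 ≤ b - t := by linarith [ht.2]
      exact abs_mul_sub_mul_le hK ((hb₂ b hb).1.trans hK₂K) ((hb₁ b hb).1.trans hK₁K)
        ((hi₁ t b (hxa.trans ht.1.le) ht.2 hby).2.1.trans (mul_le_mul hK₁K hlen hlen₀ hK))
        ((hi₂ t b (hxa.trans ht.1.le) ht.2 hby).2.1.trans (mul_le_mul hK₂K hlen hlen₀ hK))
    have hle := abs_setIntegral_sub_setIntegral_le
      ((measure_mono Ioc_subset_Icc_self).trans_lt hpab)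
      ((measure_mono Ioc_subset_Icc_self).trans_lt hmab) hbd
    rw [hcomb νp hpab, hcomb νm hmab, ← abs_neg] at hle
    rw [hg₁ a (hsub ha) b (hsub hb) hab, hg₂ a (hsub ha) b (hsub hb) hab]
    convert hle using 2
    ring
  have hdt : |g₂ a * (u₁ b - u₁ a) - g₁ a * (u₂ b - u₂ a)| ≤ 2 * K * (K * φ) * (b - a) := by
    have j₁ := (hi₁ a b hxa hab hby).2.2
    have j₂ := (hi₂ a b hxa hab hby).2.2
    have e : g₂ a * (u₁ b - u₁ a) - g₁ a * (u₂ b - u₂ a)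
        = ∫ t in a..b, (g₂ a * g₁ t - g₁ a * g₂ t) := by
      rw [intervalIntegral.integral_sub (j₁.const_mul _) (j₂.const_mul _),
        intervalIntegral.integral_const_mul, intervalIntegral.integral_const_mul,
        hug₁ a (hsub ha) b (hsub hb), hug₂ a (hsub ha) b (hsub hb)]
      ring
    rw [e, ← Real.norm_eq_abs]
    have hle : ‖∫ t in a..b, (g₂ a * g₁ t - g₁ a * g₂ t)‖ ≤ 2 * K * (K * φ) * |b - a| := by
      refine intervalIntegral.norm_integral_le_of_norm_le_const fun t ht => ?_
      rw [uIoc_of_le hab] at ht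
      have e' : g₂ a * g₁ t - g₁ a * g₂ t
          = g₂ a * (g₁ t - g₁ a) - g₁ a * (g₂ t - g₂ a) := by ring
      rw [e', Real.norm_eq_abs]
      have hst : Ioc a t ⊆ Ioc a b := Ioc_subset_Ioc_right ht.2
      have hφt : νp.real (Ioc a t) + νm.real (Ioc a t) ≤ φ :=
        add_le_add
          (measureReal_mono hst ((measure_mono Ioc_subset_Icc_self).trans_lt hpab).ne)
          (measureReal_mono hst ((measure_mono Ioc_subset_Icc_self).trans_lt hmab).ne)
      have hφt₀ : 0 ≤ νp.real (Ioc a t) + νm.real (Ioc a t) := by positivity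
      exact abs_mul_sub_mul_le hK ((hb₂ a ha).2.trans hK₂K) ((hb₁ a ha).2.trans hK₁K)
        ((hi₁ a t hxa ht.1.le (ht.2.trans hby)).1.trans (mul_le_mul hK₁K hφt hφt₀ hK))
        ((hi₂ a t hxa ht.1.le (ht.2.trans hby)).1.trans (mul_le_mul hK₂K hφt hφt₀ hK))
    rwa [abs_of_nonneg (sub_nonneg.mpr hab)] at hle
  simp only [hFφ]
  calc |u₁ b * g₂ b - u₂ b * g₁ b - (u₁ a * g₂ a - u₂ a * g₁ a)|
      = |(u₁ b * (g₂ b - g₂ a) - u₂ b * (g₁ b - g₁ a))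
          + (g₂ a * (u₁ b - u₁ a) - g₁ a * (u₂ b - u₂ a))| := by congr 1; ring
    _ ≤ 2 * K * (K * (b - a)) * φ + 2 * K * (K * φ) * (b - a) :=
        (abs_add_le _ _).trans (add_le_add hν hdt)
    _ = 4 * K * K * (b - a) * φ := by ring

/-- the Wronskian of two solutions of `u'' + u ν = 0` is constant on `I`. -/
theorem wronskian_constant_on_interval
    (I : Set ℝ) (hIopen : IsOpen I) (hIconn : I.OrdConnected)
    (νp νm : Measure ℝ)
    (hνp : ∀ x ∈ I, ∀ y ∈ I, νp (Icc x y) < ⊤)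
    (hνm : ∀ x ∈ I, ∀ y ∈ I, νm (Icc x y) < ⊤)
    (u₁ g₁ u₂ g₂ : ℝ → ℝ)
    (h₁ : IsSolutionSM I νp νm u₁ g₁) (h₂ : IsSolutionSM I νp νm u₂ g₂) :
    ∀ x ∈ I, ∀ y ∈ I,
      u₁ x * g₂ x - u₂ x * g₁ x = u₁ y * g₂ y - u₂ y * g₁ y := by
  intro x hx y hy
  rcases le_total x y with hxy | hyx
  · exact h₁.wronskian_eq_of_le hIconn h₂ hx hy hxy (hνp x hx y hy) (hνm x hx y hy)
  · exact (h₁.wronskian_eq_of_le hIconn h₂ hy hx hyx (hνp y hy x hx) (hνm y hy x hx)).symm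
end

section
/- Let I be an open interval of ℝ, ν a signed Radon measure on I, and x₀ < x₁ two points of I. (i) If u₁ is a solution of u″ + uν = 0 on I with u₁(x₀) = 0 and g₁(x₀) > 0, and u₂ is a solution with u₂(x₀) > 0 and u₂ ≥ 0 on [x₀, x₁], then u₁ > 0 on (x₀, x₁]. (ii) If u₁, u₂ are solutions with u₁(x₀) = u₂(x₀) > 0, g₁(x₀) > g₂(x₀), and u₂ ≥ 0 on [x₀, x₁], then u₁ > u₂ on (x₀, x₁]. -/
open MeasureTheory Set

theorem IsSolutionSM.mono {I J : Set ℝ} {p m : Measure ℝ} {u g : ℝ → ℝ}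
    (h : IsSolutionSM I p m u g) (hJ : J ⊆ I) : IsSolutionSM J p m u g :=
  ⟨h.1.mono hJ, fun x hx => h.2.1 x (hJ hx), fun x hx y hy => h.2.2.1 x (hJ hx) y (hJ hy),
    fun x hx y hy => h.2.2.2 x (hJ hx) y (hJ hy)⟩

/-- The distribution function, based at `a`, of the total mass of `p + m`. -/
noncomputable def totalMass (p m : Measure ℝ) (a x : ℝ) : ℝ :=
  p.real (Ioc a x) + m.real (Ioc a x)

section

variable {p m : Measure ℝ} {a b : ℝ}

theorem measureReal_Ioc_eq_sub (hp : p (Icc a b) < ⊤) {x y : ℝ} (hx : x ∈ Icc a b)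
    (hy : y ∈ Icc a b) (hxy : x ≤ y) :
    p.real (Ioc x y) = p.real (Ioc a y) - p.real (Ioc a x) := by
  have hfin {s t : ℝ} (hs : s ∈ Icc a b) (ht : t ∈ Icc a b) : p (Ioc s t) ≠ ⊤ :=
    have hsub : Ioc s t ⊆ Icc a b := fun r hr => ⟨hs.1.trans hr.1.le, hr.2.trans ht.2⟩
    ((measure_mono hsub).trans_lt hp).ne
  have ha : a ∈ Icc a b := ⟨le_rfl, hx.1.trans hx.2⟩
  rw [← Ioc_union_Ioc_eq_Ioc hx.1 hxy, measureReal_union (Ioc_disjoint_Ioc_of_le le_rfl)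
    measurableSet_Ioc (hfin ha hx) (hfin hx hy)]
  ring

theorem monotoneOn_totalMass (hp : p (Icc a b) < ⊤) (hm : m (Icc a b) < ⊤) :
    MonotoneOn (totalMass p m a) (Icc a b) := by
  intro x hx y hy hxy
  have h₁ := measureReal_Ioc_eq_sub hp hx hy hxy
  have h₂ := measureReal_Ioc_eq_sub hm hx hy hxy
  have h₃ : 0 ≤ p.real (Ioc x y) := measureReal_nonneg
  have h₄ : 0 ≤ m.real (Ioc x y) := measureReal_nonneg
  unfold totalMass
  linarith

theorem abs_setIntegral_sub_setIntegral_le_s2 (hp : p (Icc a b) < ⊤) (hm : m (Icc a b) < ⊤)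
    {x y c : ℝ} {f : ℝ → ℝ} (hx : x ∈ Icc a b) (hy : y ∈ Icc a b) (hxy : x ≤ y)
    (hf : ∀ t ∈ Ioc x y, |f t| ≤ c) :
    |(∫ t in Ioc x y, f t ∂p) - ∫ t in Ioc x y, f t ∂m| ≤
      c * (totalMass p m a y - totalMass p m a x) := by
  have hsub : Ioc x y ⊆ Icc a b := fun r hr => ⟨hx.1.trans hr.1.le, hr.2.trans hy.2⟩
  have h₁ := norm_setIntegral_le_of_norm_le_const (f := f) ((measure_mono hsub).trans_lt hp) hf
  have h₂ := norm_setIntegral_le_of_norm_le_const (f := f) ((measure_mono hsub).trans_lt hm) hf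
  rw [measureReal_Ioc_eq_sub hp hx hy hxy] at h₁
  rw [measureReal_Ioc_eq_sub hm hx hy hxy] at h₂
  refine (abs_sub _ _).trans ?_
  rw [Real.norm_eq_abs] at h₁ h₂
  unfold totalMass
  linarith

theorem IsSolutionSM.integrableOn_Ioc {u g : ℝ → ℝ} {q : Measure ℝ}
    (h : IsSolutionSM (Icc a b) p m u g) (hq : q (Icc a b) < ⊤) {x y : ℝ}
    (hx : x ∈ Icc a b) (hy : y ∈ Icc a b) : IntegrableOn u (Ioc x y) q :=
  have hsub : Ioc x y ⊆ Icc a b := fun _ hr => ⟨hx.1.trans hr.1.le, hr.2.trans hy.2⟩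
  h.1.integrableOn_of_subset_isCompact isCompact_Icc measurableSet_Ioc hsub
    ((measure_mono hsub).trans_lt hq).ne

theorem IsSolutionSM.intervalIntegrable {u g : ℝ → ℝ} (hp : p (Icc a b) < ⊤)
    (hm : m (Icc a b) < ⊤) (h : IsSolutionSM (Icc a b) p m u g) {x y : ℝ}
    (hx : x ∈ Icc a b) (hy : y ∈ Icc a b) : IntervalIntegrable g volume x y := by
  obtain ⟨M, hM⟩ := isCompact_Icc.exists_bound_of_continuousOn h.1
  have hmono : MonotoneOn (fun t => g t + M * totalMass p m a t) (Icc a b) := by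
    intro s hs t ht hst
    have := abs_setIntegral_sub_setIntegral_le_s2 (f := u) hp hm hs ht hst
      fun r hr => hM r ⟨hs.1.trans hr.1.le, hr.2.trans ht.2⟩
    have hg := h.2.2.2 s hs t ht hst
    have := (abs_le.1 this).2
    simp only
    linarith
  have hsub : uIcc x y ⊆ Icc a b := ordConnected_Icc.uIcc_subset hx hy
  have h₁ := (hmono.mono hsub).intervalIntegrable (μ := volume)
  have h₂ := (((monotoneOn_totalMass hp hm).mono hsub).intervalIntegrable (μ := volume)).const_mul M
  simpa using h₁.sub h₂

theorem IsSolutionSM.exists_bound_s2 {u g : ℝ → ℝ} (hp : p (Icc a b) < ⊤) (hm : m (Icc a b) < ⊤)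
    (h : IsSolutionSM (Icc a b) p m u g) :
    ∃ M, 0 ≤ M ∧ (∀ x ∈ Icc a b, |u x| ≤ M) ∧ (∀ x ∈ Icc a b, |g x| ≤ M) ∧
      (∀ x ∈ Icc a b, ∀ y ∈ Icc a b, x ≤ y → |u y - u x| ≤ M * (y - x)) ∧
      ∀ x ∈ Icc a b, ∀ y ∈ Icc a b, x ≤ y →
        |g y - g x| ≤ M * (totalMass p m a y - totalMass p m a x) := by
  obtain ⟨M, hM⟩ := isCompact_Icc.exists_bound_of_continuousOn h.1
  have hF := monotoneOn_totalMass hp hm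
  have hg : ∀ x ∈ Icc a b, ∀ y ∈ Icc a b, x ≤ y →
      |g y - g x| ≤ M * (totalMass p m a y - totalMass p m a x) := by
    intro x hx y hy hxy
    rw [h.2.2.2 x hx y hy hxy, abs_neg]
    exact abs_setIntegral_sub_setIntegral_le_s2 hp hm hx hy hxy
      fun r hr => hM r ⟨hx.1.trans hr.1.le, hr.2.trans hy.2⟩
  obtain ⟨N, hN⟩ : ∃ N, ∀ x ∈ Icc a b, |g x| ≤ N := by
    refine ⟨|g a| + |M| * (totalMass p m a b - totalMass p m a a), fun x hx => ?_⟩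
    have ha : a ∈ Icc a b := ⟨le_rfl, hx.1.trans hx.2⟩
    have hb : b ∈ Icc a b := ⟨hx.1.trans hx.2, le_rfl⟩
    have h₁ := hg a ha x hx hx.1
    have h₂ : M * (totalMass p m a x - totalMass p m a a) ≤
        |M| * (totalMass p m a b - totalMass p m a a) :=
      mul_le_mul (le_abs_self M) (by linarith [hF hx hb hx.2])
        (by linarith [hF ha hx hx.1]) (abs_nonneg M)
    linarith [abs_sub_abs_le_abs_sub (g x) (g a)]
  refine ⟨max 0 (max M N), le_max_left _ _,
    fun x hx => (hM x hx).trans (by simp), fun x hx => (hN x hx).trans (by simp), ?_, ?_⟩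
  · intro x hx y hy hxy
    rw [h.2.2.1 x hx y hy, add_sub_cancel_left]
    have := intervalIntegral.norm_integral_le_of_norm_le_const (f := g) (a := x) (b := y)
      (C := max 0 (max M N)) fun t ht => by
        rw [uIoc_of_le hxy] at ht
        exact (hN t ⟨hx.1.trans ht.1.le, ht.2.trans hy.2⟩).trans (by simp)
    rwa [abs_of_nonneg (sub_nonneg.2 hxy)] at this
  · intro x hx y hy hxy
    refine (hg x hx y hy hxy).trans (mul_le_mul_of_nonneg_right (by simp) ?_)
    linarith [hF hx hy hxy]

theorem IsSolutionSM.abs_sub_sub_mul_le {u g : ℝ → ℝ} {M x y : ℝ} (hp : p (Icc a b) < ⊤)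
    (hm : m (Icc a b) < ⊤) (h : IsSolutionSM (Icc a b) p m u g) (hM : 0 ≤ M)
    (hg : ∀ x ∈ Icc a b, ∀ y ∈ Icc a b, x ≤ y →
      |g y - g x| ≤ M * (totalMass p m a y - totalMass p m a x))
    (hx : x ∈ Icc a b) (hy : y ∈ Icc a b) (hxy : x ≤ y) :
    |u y - u x - g y * (y - x)| ≤
      M * (totalMass p m a y - totalMass p m a x) * (y - x) := by
  have hint : u y - u x - g y * (y - x) = ∫ t in x..y, (g t - g y) := by
    rw [intervalIntegral.integral_sub (h.intervalIntegrable hp hm hx hy) (by simp),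
      intervalIntegral.integral_const, smul_eq_mul, h.2.2.1 x hx y hy]
    ring
  rw [hint]
  have := intervalIntegral.norm_integral_le_of_norm_le_const (f := fun t => g t - g y) (a := x)
    (b := y) (C := M * (totalMass p m a y - totalMass p m a x)) fun t ht => by
      rw [uIoc_of_le hxy] at ht
      have ht' : t ∈ Icc a b := ⟨hx.1.trans ht.1.le, ht.2.trans hy.2⟩
      rw [Real.norm_eq_abs, abs_sub_comm]
      refine (hg t ht' y hy ht.2).trans (mul_le_mul_of_nonneg_left ?_ hM)
      linarith [monotoneOn_totalMass hp hm hx ht' ht.1.le]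
  rwa [abs_of_nonneg (sub_nonneg.2 hxy)] at this

theorem eq_of_abs_sub_le_mul_sub {w F : ℝ → ℝ} {C : ℝ} (hab : a ≤ b)
    (h : ∀ x ∈ Icc a b, ∀ y ∈ Icc a b, x ≤ y → |w y - w x| ≤ C * (y - x) * (F y - F x)) :
    w b = w a := by
  have key (n : ℕ) : |w b - w a| ≤ C * (b - a) * (F b - F a) * (1 / ((n : ℝ) + 1)) := by
    have hn : (0 : ℝ) < n + 1 := by positivity
    set d : ℝ := (b - a) / (n + 1) with hd
    have hd0 : 0 ≤ d := div_nonneg (sub_nonneg.2 hab) hn.le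
    have hdn : (n + 1) * d = b - a := by rw [hd]; field_simp
    have step (k : ℕ) (hk : k ≤ n + 1) :
        |w (a + k * d) - w a| ≤ C * d * (F (a + k * d) - F a) := by
      induction k with
      | zero => simp
      | succ k ih =>
        have hk' : (k : ℝ) + 1 ≤ n + 1 := by exact_mod_cast hk
        have hle : ((k : ℝ) + 1) * d ≤ b - a :=
          hdn ▸ mul_le_mul_of_nonneg_right hk' hd0
        have hkd : 0 ≤ (k : ℝ) * d := by positivity
        have h₁ := h (a + k * d) ⟨by linarith, by linarith⟩ (a + (k + 1) * d)
          ⟨by linarith, by linarith⟩ (by linarith)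
        have h₂ := ih (by omega)
        have h₃ := abs_sub_le (w (a + (k + 1) * d)) (w (a + k * d)) (w a)
        rw [show a + (k + 1) * d - (a + k * d) = d by ring] at h₁
        push_cast
        linarith
    have hlast := step (n + 1) le_rfl
    push_cast at hlast
    rw [hdn, add_sub_cancel] at hlast
    refine hlast.trans_eq ?_
    rw [hd]
    ring
  have hlim : Filter.Tendsto (fun n : ℕ => C * (b - a) * (F b - F a) * (1 / ((n : ℝ) + 1)))
      Filter.atTop (nhds 0) := by
    simpa using tendsto_one_div_add_atTop_nhds_zero_nat.const_mul (C * (b - a) * (F b - F a))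
  have h0 := ge_of_tendsto' hlim key
  exact sub_eq_zero.1 (abs_nonpos_iff.1 h0)

theorem IsSolutionSM.wronskian_eq {u₁ g₁ u₂ g₂ : ℝ → ℝ} (hp : p (Icc a b) < ⊤)
    (hm : m (Icc a b) < ⊤) (hab : a ≤ b) (h₁ : IsSolutionSM (Icc a b) p m u₁ g₁)
    (h₂ : IsSolutionSM (Icc a b) p m u₂ g₂) :
    u₂ b * g₁ b - u₁ b * g₂ b = u₂ a * g₁ a - u₁ a * g₂ a := by
  obtain ⟨M, hM, hu₁, hg₁, hdu₁, hdg₁⟩ := h₁.exists_bound_s2 hp hm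
  obtain ⟨N, hN, hu₂, hg₂, hdu₂, hdg₂⟩ := h₂.exists_bound_s2 hp hm
  refine eq_of_abs_sub_le_mul_sub (w := fun x => u₂ x * g₁ x - u₁ x * g₂ x)
    (F := totalMass p m a) (C := 4 * (M * N)) hab fun x hx y hy hxy => ?_
  set T := totalMass p m a y - totalMass p m a x
  have hT : 0 ≤ T := sub_nonneg.2 (monotoneOn_totalMass hp hm hx hy hxy)
  have hd : 0 ≤ y - x := sub_nonneg.2 hxy
  have e₁ : |(u₂ y - u₂ x - g₂ y * (y - x)) * g₁ y| ≤ N * T * (y - x) * M := by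
    rw [abs_mul]
    exact mul_le_mul (h₂.abs_sub_sub_mul_le hp hm hN hdg₂ hx hy hxy) (hg₁ y hy)
      (abs_nonneg _) (by positivity)
  have e₂ : |(u₁ y - u₁ x - g₁ y * (y - x)) * g₂ y| ≤ M * T * (y - x) * N := by
    rw [abs_mul]
    exact mul_le_mul (h₁.abs_sub_sub_mul_le hp hm hM hdg₁ hx hy hxy) (hg₂ y hy)
      (abs_nonneg _) (by positivity)
  have e₃ : |u₂ x * (g₁ y - g₁ x) - u₁ x * (g₂ y - g₂ x)| ≤ 2 * (M * N) * (y - x) * T := by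
    have hint (q : Measure ℝ) (hq : q (Icc a b) < ⊤) :
        ∫ t in Ioc x y, (u₁ x * u₂ t - u₂ x * u₁ t) ∂q =
          u₁ x * (∫ t in Ioc x y, u₂ t ∂q) - u₂ x * ∫ t in Ioc x y, u₁ t ∂q := by
      rw [integral_sub ((h₂.integrableOn_Ioc hq hx hy).const_mul _)
        ((h₁.integrableOn_Ioc hq hx hy).const_mul _), integral_const_mul, integral_const_mul]
    have heq : u₂ x * (g₁ y - g₁ x) - u₁ x * (g₂ y - g₂ x) =
        (∫ t in Ioc x y, (u₁ x * u₂ t - u₂ x * u₁ t) ∂p) -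
          ∫ t in Ioc x y, (u₁ x * u₂ t - u₂ x * u₁ t) ∂m := by
      rw [hint p hp, hint m hm, h₁.2.2.2 x hx y hy hxy, h₂.2.2.2 x hx y hy hxy]
      ring
    rw [heq]
    refine abs_setIntegral_sub_setIntegral_le_s2 hp hm hx hy hxy fun t ht => ?_
    have ht' : t ∈ Icc a b := ⟨hx.1.trans ht.1.le, ht.2.trans hy.2⟩
    have htd : 0 ≤ t - x := sub_nonneg.2 ht.1.le
    have b₁ : |u₁ x * (u₂ t - u₂ x)| ≤ M * (N * (t - x)) := by
      rw [abs_mul]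
      exact mul_le_mul (hu₁ x hx) (hdu₂ x hx t ht' ht.1.le) (abs_nonneg _) hM
    have b₂ : |u₂ x * (u₁ t - u₁ x)| ≤ N * (M * (t - x)) := by
      rw [abs_mul]
      exact mul_le_mul (hu₂ x hx) (hdu₁ x hx t ht' ht.1.le) (abs_nonneg _) hN
    have b₃ : 2 * (M * N) * (t - x) ≤ 2 * (M * N) * (y - x) :=
      mul_le_mul_of_nonneg_left (by linarith [ht.2]) (by positivity)
    calc |u₁ x * u₂ t - u₂ x * u₁ t|
        = |u₁ x * (u₂ t - u₂ x) - u₂ x * (u₁ t - u₁ x)| := by ring_nf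
      _ ≤ _ := abs_sub _ _
      _ ≤ 2 * (M * N) * (y - x) := by linarith
  have hsplit : u₂ y * g₁ y - u₁ y * g₂ y - (u₂ x * g₁ x - u₁ x * g₂ x) =
      (u₂ y - u₂ x - g₂ y * (y - x)) * g₁ y - (u₁ y - u₁ x - g₁ y * (y - x)) * g₂ y +
        (u₂ x * (g₁ y - g₁ x) - u₁ x * (g₂ y - g₂ x)) := by ring
  simp only [hsplit]
  rw [abs_le] at *
  constructor <;> linarith

theorem IsSolutionSM.exists_pos_right {u g : ℝ → ℝ} (hp : p (Icc a b) < ⊤)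
    (hm : m (Icc a b) < ⊤) (hab : a < b) (h : IsSolutionSM (Icc a b) p m u g)
    (hu : u a = 0) (hg : 0 < g a) : ∃ c ∈ Ioc a b, ∀ x ∈ Ioc a c, 0 < u x := by
  have ha : a ∈ Icc a b := ⟨le_rfl, hab.le⟩
  have hev := (h.2.1 a ha).eventually (lt_mem_nhds hg)
  obtain ⟨c, hc, hsub⟩ := (mem_nhdsGE_iff_exists_Ico_subset' hab).1 hev
  obtain ⟨d, hd⟩ := exists_between (lt_min (show a < c from hc) hab)
  have hdc := hd.2.trans_le (min_le_left c b)
  have hdb := hd.2.trans_le (min_le_right c b)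
  refine ⟨d, ⟨hd.1, hdb.le⟩, fun x hx => ?_⟩
  have hx' : x ∈ Icc a b := ⟨hx.1.le, hx.2.trans hdb.le⟩
  rw [h.2.2.1 a ha x hx', hu, zero_add]
  exact intervalIntegral.intervalIntegral_pos_of_pos_on (h.intervalIntegrable hp hm ha hx')
    (fun t ht => hsub ⟨ht.1.le, (ht.2.trans_le hx.2).trans hdc⟩) hx.1

theorem IsSolutionSM.exists_neg_left {u g : ℝ → ℝ} (hp : p (Icc a b) < ⊤)
    (hm : m (Icc a b) < ⊤) (hab : a < b) (h : IsSolutionSM (Icc a b) p m u g)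
    (hu : u b = 0) (hg : 0 < g b) : ∃ c ∈ Ico a b, ∀ x ∈ Ico c b, u x < 0 := by
  obtain ⟨M, hM, -, -, hdu, -⟩ := h.exists_bound_s2 hp hm
  have ha : a ∈ Icc a b := ⟨le_rfl, hab.le⟩
  have hb : b ∈ Icc a b := ⟨hab.le, le_rfl⟩
  set T := totalMass p m a b - totalMass p m a a
  have hT : 0 ≤ T := sub_nonneg.2 (monotoneOn_totalMass hp hm ha hb hab.le)
  have hMT : 0 < M * T + 1 := by positivity
  set δ := g b / (M * T + 1)
  have hδ : 0 < δ := div_pos hg hMT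
  have hδ' : δ * (M * T + 1) = g b := div_mul_cancel₀ _ hMT.ne'
  have hpos : ∀ t ∈ Icc a b, b - δ ≤ t → 0 < g t := by
    intro t ht hδt
    have hle := abs_setIntegral_sub_setIntegral_le_s2 (f := u) (c := M * δ) hp hm ht hb ht.2
      fun r hr => by
        have hr' := hdu r ⟨ht.1.trans hr.1.le, hr.2⟩ b hb hr.2
        rw [hu, zero_sub, abs_neg] at hr'
        exact hr'.trans (mul_le_mul_of_nonneg_left (by linarith [hr.1]) hM)
    have hmass : M * δ * (totalMass p m a b - totalMass p m a t) ≤ M * δ * T :=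
      mul_le_mul_of_nonneg_left
        (by linarith [monotoneOn_totalMass hp hm ha ht ht.1]) (by positivity)
    have hgt := h.2.2.2 t ht b hb ht.2
    have := (abs_le.1 hle).1
    linarith
  refine ⟨max a (b - δ), ⟨le_max_left _ _, max_lt hab (by linarith)⟩, fun x hx => ?_⟩
  have hx' : x ∈ Icc a b := ⟨(le_max_left _ _).trans hx.1, hx.2.le⟩
  have hint := intervalIntegral.intervalIntegral_pos_of_pos_on
    (h.intervalIntegrable hp hm hx' hb) (fun t ht => hpos t ⟨hx'.1.trans ht.1.le, ht.2.le⟩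
      (((le_max_right _ _).trans hx.1).trans ht.1.le)) hx.2
  have := h.2.2.1 x hx' b hb
  linarith

theorem IsSolutionSM.pos_of_nonneg {u₁ g₁ u₂ g₂ : ℝ → ℝ} (hp : p (Icc a b) < ⊤)
    (hm : m (Icc a b) < ⊤) (hab : a < b) (h₁ : IsSolutionSM (Icc a b) p m u₁ g₁)
    (h₂ : IsSolutionSM (Icc a b) p m u₂ g₂) (hu₁ : u₁ a = 0) (hg₁ : 0 < g₁ a)
    (hu₂ : 0 < u₂ a) (hnonneg : ∀ x ∈ Icc a b, 0 ≤ u₂ x) :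
    ∀ x ∈ Ioc a b, 0 < u₁ x := by
  obtain ⟨c, hc, hpos⟩ := h₁.exists_pos_right hp hm hab hu₁ hg₁
  by_contra! ⟨x, hx, hux⟩
  have hcx : c < x := by
    by_contra! hxc
    exact (hpos x ⟨hx.1, hxc⟩).not_ge hux
  have hsub : Icc c x ⊆ Icc a b := Icc_subset_Icc hc.1.le hx.2
  have hcont : ContinuousOn u₁ (Icc c x) := h₁.1.mono hsub
  have hK : IsCompact (Icc c x ∩ u₁ ⁻¹' Iic 0) :=
    isCompact_Icc.of_isClosed_subset
      (hcont.preimage_isClosed_of_isClosed isClosed_Icc isClosed_Iic) inter_subset_left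
  obtain ⟨z, ⟨hz, huz⟩, hleast⟩ := hK.exists_isLeast ⟨x, ⟨hcx.le, le_rfl⟩, hux⟩
  have huc := hpos c ⟨hc.1, le_rfl⟩
  obtain ⟨w, hw, huw⟩ := intermediate_value_Icc' hz.1
    (hcont.mono (Icc_subset_Icc_right hz.2)) ⟨huz, huc.le⟩
  have huz0 : u₁ z = 0 := by
    rwa [hw.2.antisymm (hleast ⟨⟨hw.1, hw.2.trans hz.2⟩, huw.le⟩)] at huw
  have hcz : c < z := hz.1.lt_of_ne (by rintro rfl; exact huc.ne' huz0)
  have haz : a < z := hc.1.trans hcz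
  have hzb : z ≤ b := (hsub hz).2
  have hsubz : Icc a z ⊆ Icc a b := Icc_subset_Icc_right hzb
  have hpz := (measure_mono hsubz).trans_lt hp
  have hmz := (measure_mono hsubz).trans_lt hm
  have hw := (h₁.mono hsubz).wronskian_eq hpz hmz haz.le (h₂.mono hsubz)
  rw [huz0, hu₁, zero_mul, zero_mul, sub_zero, sub_zero] at hw
  have hgz : 0 < g₁ z :=
    pos_of_mul_pos_right (hw ▸ mul_pos hu₂ hg₁) (hnonneg z (hsub hz))
  obtain ⟨d, hd, hneg⟩ := (h₁.mono hsubz).exists_neg_left hpz hmz haz huz0 hgz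
  have hy := hneg (max c d) ⟨le_max_right _ _, max_lt hcz hd.2⟩
  have hyz : max c d < z := max_lt hcz hd.2
  exact hyz.not_ge (hleast ⟨⟨le_max_left _ _, hyz.le.trans hz.2⟩, hy.le⟩)

theorem IsSolutionSM.sub {u₁ g₁ u₂ g₂ : ℝ → ℝ} (hp : p (Icc a b) < ⊤)
    (hm : m (Icc a b) < ⊤) (h₁ : IsSolutionSM (Icc a b) p m u₁ g₁)
    (h₂ : IsSolutionSM (Icc a b) p m u₂ g₂) :
    IsSolutionSM (Icc a b) p m (fun x => u₁ x - u₂ x) (fun x => g₁ x - g₂ x) := by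
  refine ⟨h₁.1.sub h₂.1, fun x hx => (h₁.2.1 x hx).sub (h₂.2.1 x hx), ?_, ?_⟩
  · intro x hx y hy
    rw [intervalIntegral.integral_sub (h₁.intervalIntegrable hp hm hx hy)
      (h₂.intervalIntegrable hp hm hx hy)]
    linarith [h₁.2.2.1 x hx y hy, h₂.2.2.1 x hx y hy]
  · intro x hx y hy hxy
    rw [integral_sub (h₁.integrableOn_Ioc hp hx hy) (h₂.integrableOn_Ioc hp hx hy),
      integral_sub (h₁.integrableOn_Ioc hm hx hy) (h₂.integrableOn_Ioc hm hx hy)]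
    linarith [h₁.2.2.2 x hx y hy hxy, h₂.2.2.2 x hx y hy hxy]

end

/-- a Sturm-type comparison property for solutions of `u'' + u ν = 0`. -/
theorem sturm_comparison
    (I : Set ℝ) (hIopen : IsOpen I) (hIconn : I.OrdConnected)
    (νp νm : Measure ℝ)
    (hνp : ∀ x ∈ I, ∀ y ∈ I, νp (Icc x y) < ⊤)
    (hνm : ∀ x ∈ I, ∀ y ∈ I, νm (Icc x y) < ⊤)
    (x₀ x₁ : ℝ) (hx₀ : x₀ ∈ I) (hx₁ : x₁ ∈ I) (h01 : x₀ < x₁) :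
    (∀ u₁ g₁ u₂ g₂ : ℝ → ℝ,
      IsSolutionSM I νp νm u₁ g₁ → IsSolutionSM I νp νm u₂ g₂ →
      u₁ x₀ = 0 → 0 < g₁ x₀ → 0 < u₂ x₀ → (∀ x ∈ Icc x₀ x₁, 0 ≤ u₂ x) →
      ∀ x ∈ Ioc x₀ x₁, 0 < u₁ x) ∧
    (∀ u₁ g₁ u₂ g₂ : ℝ → ℝ,
      IsSolutionSM I νp νm u₁ g₁ → IsSolutionSM I νp νm u₂ g₂ →
      u₁ x₀ = u₂ x₀ → 0 < u₁ x₀ → g₂ x₀ < g₁ x₀ → (∀ x ∈ Icc x₀ x₁, 0 ≤ u₂ x) →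
      ∀ x ∈ Ioc x₀ x₁, u₂ x < u₁ x) := by
  have hsub : Icc x₀ x₁ ⊆ I := hIconn.out hx₀ hx₁
  have hp := hνp x₀ hx₀ x₁ hx₁
  have hm := hνm x₀ hx₀ x₁ hx₁
  refine ⟨fun u₁ g₁ u₂ g₂ h₁ h₂ hu₁ hg₁ hu₂ hnonneg =>
    (h₁.mono hsub).pos_of_nonneg hp hm h01 (h₂.mono hsub) hu₁ hg₁ hu₂ hnonneg, ?_⟩
  intro u₁ g₁ u₂ g₂ h₁ h₂ hu hu₁ hg hnonneg x hx
  exact sub_pos.1 <| ((h₁.mono hsub).sub hp hm (h₂.mono hsub)).pos_of_nonneg hp hm h01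
    (h₂.mono hsub) (sub_eq_zero.2 hu) (sub_pos.2 hg) (hu ▸ hu₁) hnonneg x hx
end

section
/- Let I be an open interval of ℝ, ν a signed Radon measure on I with positive part ν₊, and x₀ < x₁ two points of I. Let f be a continuous positive function on [x₀, x₁] such that min_{[x₀,x₁]} f > (ν₊([x₀, x₁]))². Then the equation u″ + uν − uf = 0 admits a solution on [x₀, x₁] that is positive and non-decreasing on [x₀, x₁]. -/
open MeasureTheory Set

/-- `u` is a solution of `u'' + u ν - u f = 0` on `[x₀, x₁]`, where the signed Radon
measure `ν` is represented as the difference `νp - νm` of two positive Borel measures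
and `f` is a (continuous) function; `g` is the right-continuous right-derivative of `u`. -/
def IsSolutionSMF (x₀ x₁ : ℝ) (νp νm : Measure ℝ) (f u g : ℝ → ℝ) : Prop :=
  ContinuousOn u (Icc x₀ x₁) ∧
  (∀ x ∈ Icc x₀ x₁, ContinuousWithinAt g (Ici x) x) ∧
  (∀ x' ∈ Icc x₀ x₁, ∀ x ∈ Icc x₀ x₁, u x = u x' + ∫ t in x'..x, g t) ∧
  (∀ x' ∈ Icc x₀ x₁, ∀ x ∈ Icc x₀ x₁, x' ≤ x →
    g x - g x' = -((∫ t in Ioc x' x, u t ∂νp) - ∫ t in Ioc x' x, u t ∂νm)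
      + ∫ t in x'..x, u t * f t)

/-- Primitives of a continuous function against a finite measure are measurable. -/
lemma stronglyMeasurable_setIntegral_Ioc (P : Measure ℝ) [IsFiniteMeasure P] (a : ℝ) {u : ℝ → ℝ}
    (hu : Continuous u) : StronglyMeasurable fun t => ∫ s in Ioc a t, u s ∂P := by
  have hset : MeasurableSet {p : ℝ × ℝ | a < p.2 ∧ p.2 ≤ p.1} :=
    (measurableSet_lt measurable_const measurable_snd).inter
      (measurableSet_le measurable_snd measurable_fst)
  have h : StronglyMeasurable
      ({p : ℝ × ℝ | a < p.2 ∧ p.2 ≤ p.1}.indicator fun p => u p.2) :=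
    (hu.comp continuous_snd).stronglyMeasurable.indicator hset
  simp_rw [← integral_indicator measurableSet_Ioc]
  exact h.integral_prod_right' (ν := P)

lemma continuousWithinAt_setIntegral_Ioc (P : Measure ℝ) (a x : ℝ) {u : ℝ → ℝ}
    (hu : Integrable u P) :
    ContinuousWithinAt (fun t => ∫ s in Ioc a t, u s ∂P) (Ici x) x := by
  simp_rw [← integral_indicator measurableSet_Ioc]
  refine tendsto_integral_filter_of_dominated_convergence (fun s => ‖u s‖)
    (.of_forall fun t => hu.aestronglyMeasurable.indicator measurableSet_Ioc)
    (.of_forall fun t => .of_forall fun s => norm_indicator_le_norm_self _ _) hu.norm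
    (.of_forall fun s => tendsto_const_nhds.congr' ?_)
  rcases le_or_gt s x with h | h
  · filter_upwards [self_mem_nhdsWithin] with t ht
    simp [indicator, h, h.trans (mem_Ici.1 ht)]
  · filter_upwards [nhdsWithin_le_nhds (Iio_mem_nhds h)] with t ht
    simp [indicator, h.not_ge, not_le.2 (mem_Iio.1 ht)]

lemma norm_setIntegral_Ioc_le (P : Measure ℝ) [IsFiniteMeasure P] {a t B : ℝ} {u : ℝ → ℝ}
    (hB : 0 ≤ B) (hu : ∀ s ∈ Ioc a t, ‖u s‖ ≤ B) :
    ‖∫ s in Ioc a t, u s ∂P‖ ≤ P.real univ * B := by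
  refine (norm_setIntegral_le_of_norm_le_const (measure_lt_top _ _) hu).trans ?_
  rw [mul_comm]
  exact mul_le_mul_of_nonneg_right (measureReal_mono (subset_univ _)) hB

/-- The right-derivative attached to `u` by the equation `u'' + u (P - Q) = 0`, with value `c`
at `a`. -/
noncomputable def rightDerivSMF (P Q : Measure ℝ) (a c : ℝ) (u : ℝ → ℝ) (t : ℝ) : ℝ :=
  c - ∫ s in Ioc a t, u s ∂P + ∫ s in Ioc a t, u s ∂Q

lemma intervalIntegrable_rightDerivSMF (P Q : Measure ℝ) [IsFiniteMeasure P] [IsFiniteMeasure Q]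
    (a c : ℝ) {u : ℝ → ℝ} {B : ℝ} (hu : Continuous u) (hB : ∀ s, ‖u s‖ ≤ B) (x y : ℝ) :
    IntervalIntegrable (rightDerivSMF P Q a c u) volume x y := by
  have hB0 : 0 ≤ B := (norm_nonneg _).trans (hB 0)
  have h : ∀ (ρ : Measure ℝ) [IsFiniteMeasure ρ],
      IntervalIntegrable (fun t => ∫ s in Ioc a t, u s ∂ρ) volume x y := fun ρ _ =>
    (intervalIntegrable_const (c := ρ.real univ * B)).mono_fun
      (stronglyMeasurable_setIntegral_Ioc ρ a hu).aestronglyMeasurable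
      (.of_forall fun t => (norm_setIntegral_Ioc_le ρ hB0 fun s _ => hB s).trans (le_abs_self _))
  exact (intervalIntegrable_const.sub (h P)).add (h Q)

/-- Existence for the initial value problem `u'' + u (P - Q) = 0`, `u a = 1`, `u' a = c`. -/
lemma exists_solution_integral_equation (P Q : Measure ℝ) [IsFiniteMeasure P] [IsFiniteMeasure Q]
    {a b : ℝ} (hab : a ≤ b) (c : ℝ) :
    ∃ u : ℝ → ℝ, Continuous u ∧ (∃ B, ∀ s, ‖u s‖ ≤ B) ∧
      ∀ x ∈ Icc a b, u x = 1 + ∫ t in a..x, rightDerivSMF P Q a c u t := by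
  set C : ℝ := P.real univ + Q.real univ with hC
  have hC0 : 0 ≤ C := by positivity
  set K : ℝ := 2 * C + 1 with hK
  have hK0 : 0 < K := by positivity
  let ext (w : C(Icc a b, ℝ)) : ℝ → ℝ :=
    IccExtend hab fun x : Icc a b => Real.exp (K * x) * w x
  have ext_cont (w : C(Icc a b, ℝ)) : Continuous (ext w) := by
    refine Continuous.Icc_extend' ?_
    fun_prop
  have ext_bdd (w : C(Icc a b, ℝ)) (s : ℝ) : ‖ext w s‖ ≤ Real.exp (K * b) * ‖w‖ := by
    simp only [ext, IccExtend, Function.comp_apply, norm_mul, Real.norm_eq_abs, Real.abs_exp]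
    gcongr
    · exact (projIcc a b hab s).2.2
    · exact w.norm_coe_le_norm _
  have ext_dist (w v : C(Icc a b, ℝ)) {s t : ℝ} (hs : s ∈ Icc a b) (hst : s ≤ t) :
      ‖ext w s - ext v s‖ ≤ Real.exp (K * t) * dist w v := by
    simp only [ext, IccExtend_of_mem _ _ hs, ← mul_sub, norm_mul, Real.norm_eq_abs, Real.abs_exp]
    gcongr
    exact ContinuousMap.dist_apply_le_dist (f := w) (g := v) ⟨s, hs⟩
  have ext_int (w : C(Icc a b, ℝ)) (ρ : Measure ℝ) [IsFiniteMeasure ρ] : Integrable (ext w) ρ :=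
    .of_bound (ext_cont w).aestronglyMeasurable _ (.of_forall (ext_bdd w))
  let F (w : C(Icc a b, ℝ)) : ℝ → ℝ := rightDerivSMF P Q a c (ext w)
  have F_int (w : C(Icc a b, ℝ)) (x y : ℝ) : IntervalIntegrable (F w) volume x y :=
    intervalIntegrable_rightDerivSMF P Q a c (ext_cont w) (ext_bdd w) x y
  have F_dist (w v : C(Icc a b, ℝ)) {t : ℝ} (ht : t ∈ Icc a b) :
      ‖F w t - F v t‖ ≤ C * dist w v * Real.exp (K * t) := by
    have h (ρ : Measure ℝ) [IsFiniteMeasure ρ] :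
        ‖(∫ s in Ioc a t, ext w s ∂ρ) - ∫ s in Ioc a t, ext v s ∂ρ‖
          ≤ ρ.real univ * (Real.exp (K * t) * dist w v) := by
      rw [← integral_sub (ext_int w _) (ext_int v _)]
      exact norm_setIntegral_Ioc_le ρ (by positivity)
        fun s hs => ext_dist w v ⟨hs.1.le, hs.2.trans ht.2⟩ hs.2
    have hP := h P
    have hQ := h Q
    rw [Real.norm_eq_abs, abs_le] at *
    constructor <;> simp only [F, rightDerivSMF, hC] <;> linarith
  let T (w : C(Icc a b, ℝ)) : C(Icc a b, ℝ) :=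
    ⟨fun x => Real.exp (-(K * x)) * (1 + ∫ t in a..x, F w t), by
      have := (intervalIntegral.continuous_primitive (F_int w) a).comp
        (continuous_subtype_val (p := fun x => x ∈ Icc a b))
      simp only [Function.comp_def] at this
      fun_prop⟩
  have hT : ContractingWith (1 / 2) T := by
    refine ⟨by rw [← NNReal.coe_lt_coe]; norm_num, LipschitzWith.of_dist_le_mul fun w v => ?_⟩
    rw [ContinuousMap.dist_le (by positivity)]
    intro x
    have h1 : ‖(∫ t in a..x, F w t) - ∫ t in a..x, F v t‖
        ≤ ∫ t in a..x, C * dist w v * Real.exp (K * t) := by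
      rw [← intervalIntegral.integral_sub (F_int w _ _) (F_int v _ _)]
      refine intervalIntegral.norm_integral_le_of_norm_le x.2.1 (.of_forall fun t ht =>
        F_dist w v ⟨ht.1.le, ht.2.trans x.2.2⟩) ?_
      exact Continuous.intervalIntegrable (by fun_prop) _ _
    have h2 : ∫ t in a..x, C * dist w v * Real.exp (K * t)
        = C * dist w v * (K⁻¹ * (Real.exp (K * x) - Real.exp (K * a))) := by
      simp [intervalIntegral.integral_comp_mul_left (fun t => Real.exp t) hK0.ne']
    have h3 : C * K⁻¹ ≤ 1 / 2 := by
      rw [← div_eq_mul_inv, div_le_iff₀ hK0]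
      linarith
    calc dist (T w x) (T v x)
        = Real.exp (-(K * x)) * ‖(∫ t in a..x, F w t) - ∫ t in a..x, F v t‖ := by
          simp only [T, ContinuousMap.coe_mk, Real.dist_eq, ← mul_sub, abs_mul, Real.abs_exp,
            add_sub_add_left_eq_sub, Real.norm_eq_abs]
      _ ≤ Real.exp (-(K * x)) * (C * dist w v * (K⁻¹ * Real.exp (K * x))) := by
          gcongr
          refine h1.trans (h2.le.trans ?_)
          gcongr
          linarith [Real.exp_pos (K * a)]
      _ = C * K⁻¹ * dist w v * (Real.exp (-(K * x)) * Real.exp (K * x)) := by ring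
      _ = C * K⁻¹ * dist w v := by rw [← Real.exp_add]; simp
      _ ≤ ((1 / 2 : NNReal) : ℝ) * dist w v := by
          gcongr
          simpa using h3
  set w := hT.fixedPoint T
  have hw : T w = w := hT.fixedPoint_isFixedPt
  refine ⟨ext w, ext_cont w, ⟨_, ext_bdd w⟩, fun x hx => ?_⟩
  have h : Real.exp (-(K * x)) * (1 + ∫ t in a..x, F w t) = w ⟨x, hx⟩ :=
    congrArg (fun z : C(Icc a b, ℝ) => z ⟨x, hx⟩) hw
  simp only [ext, IccExtend_of_mem _ _ hx]
  rw [← h, ← mul_assoc, ← Real.exp_add]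
  simp [F, ext]

/-- Differential inequality behind positivity: if `g` is the right-derivative of `u`, and on every
initial interval where `u` is positive and maximal at the right end `g` decreases by at most
`M * u x - L ^ 2 * ∫ u`, then starting from `g a = L > M` it stays nonnegative. -/
lemma nonneg_of_rightDeriv_lower_bound {a b M L : ℝ} (hM : 0 ≤ M) (hML : M < L)
    {u g : ℝ → ℝ} (hu : Continuous u) (hint : ∀ x y, IntervalIntegrable g volume x y)
    (hua : u a = 1) (hug : ∀ x ∈ Icc a b, ∀ y ∈ Icc a b, u y - u x = ∫ t in x..y, g t)
    (hga : g a = L) (hgr : ∀ x, ContinuousWithinAt g (Ici x) x)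
    (hg : ∀ x ∈ Icc a b, (∀ s ∈ Icc a x, 1 ≤ u s ∧ u s ≤ u x) → ∀ t ∈ Icc a x,
      L ^ 2 * (∫ s in t..x, u s) - M * u x ≤ g x - g t) :
    ∀ x ∈ Icc a b, 0 ≤ g x := by
  by_contra! hneg
  have hL : 0 < L := hM.trans_lt hML
  set S : Set ℝ := {y | y ∈ Icc a b ∧ g y < 0}
  have hSne : S.Nonempty := hneg
  have hSbdd : BddBelow S := ⟨a, fun y hy => hy.1.1⟩
  set x := sInf S
  have hax : a ≤ x := le_csInf hSne fun y hy => hy.1.1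
  have hxb : x ≤ b := (csInf_le hSbdd hSne.some_mem).trans hSne.some_mem.1.2
  have hgx : ∀ t, a ≤ t → t < x → 0 ≤ g t := fun t h1 h2 => by
    by_contra! h
    exact (notMem_of_lt_csInf h2 hSbdd) ⟨⟨h1, h2.le.trans hxb⟩, h⟩
  have hmono : ∀ s ∈ Icc a x, ∀ t ∈ Icc a x, s ≤ t → u s ≤ u t := fun s hs t ht hst => by
    rw [← sub_nonneg, hug s ⟨hs.1, hs.2.trans hxb⟩ t ⟨ht.1, ht.2.trans hxb⟩]
    have := intervalIntegral.integral_mono_on_of_le_Ioo hst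
      (intervalIntegrable_const (c := (0 : ℝ))) (hint s t)
      fun r hr => hgx r (hs.1.trans hr.1.le) (hr.2.trans_le ht.2)
    simpa using this
  have hux : ∀ s ∈ Icc a x, 1 ≤ u s ∧ u s ≤ u x := fun s hs =>
    ⟨hua ▸ hmono a (left_mem_Icc.2 hax) s hs hs.1, hmono s hs x (right_mem_Icc.2 hax) hs.2⟩
  have hux1 : 1 ≤ u x := (hux x (right_mem_Icc.2 hax)).1
  have hpos : 0 < g x := by
    set A : Set ℝ := {t | t ∈ Icc a x ∧ L * u t ≤ g t}
    have hAne : A.Nonempty := ⟨a, left_mem_Icc.2 hax, by rw [hua, hga, mul_one]⟩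
    have hAbdd : BddAbove A := ⟨x, fun t ht => ht.1.2⟩
    set p := sSup A
    have hpx : p ≤ x := csSup_le hAne fun t ht => ht.1.2
    have hop : IsOpen {t | L * (u p - u t) < (L - M) * u x} :=
      isOpen_lt (by fun_prop) continuous_const
    obtain ⟨t, ht, htA⟩ := mem_closure_iff.1 (csSup_mem_closure hAne hAbdd) _ hop (by
      have : 0 < (L - M) * u x := mul_pos (sub_pos.2 hML) (by linarith)
      simpa [p] using this)
    have htp : t ≤ p := le_csSup hAbdd htA
    have hap : a ≤ p := htA.1.1.trans htp
    have h1 := hg x ⟨hax, hxb⟩ hux t htA.1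
    have h2 : L * (u x - u p) ≤ L ^ 2 * ∫ s in p..x, u s := by
      rw [hug p ⟨hap, hpx.trans hxb⟩ x ⟨hax, hxb⟩, ← intervalIntegral.integral_const_mul,
        ← intervalIntegral.integral_const_mul]
      refine intervalIntegral.integral_mono_on_of_le_Ioo hpx ((hint p x).const_mul L)
        (Continuous.intervalIntegrable (by fun_prop) _ _) fun s hs => ?_
      have : g s < L * u s := by
        by_contra! h
        exact notMem_of_csSup_lt hs.1 hAbdd ⟨⟨hap.trans hs.1.le, hs.2.le⟩, h⟩
      nlinarith
    have h3 : 0 ≤ ∫ s in t..p, u s := intervalIntegral.integral_nonneg htp fun s hs =>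
      zero_le_one.trans (hux s ⟨htA.1.1.trans hs.1, hs.2.trans hpx⟩).1
    rw [← intervalIntegral.integral_add_adjacent_intervals
      (hu.intervalIntegrable t p) (hu.intervalIntegrable p x), mul_add] at h1
    have h4 : 0 ≤ L ^ 2 * ∫ s in t..p, u s := by positivity
    have h5 := htA.2
    have h6 : L * (u p - u t) < (L - M) * u x := ht
    linarith
  obtain ⟨o, ho, hxo, hosub⟩ := mem_nhdsWithin.1 ((hgr x).eventually (lt_mem_nhds hpos))
  obtain ⟨y, hyo, hyS⟩ := mem_closure_iff.1 (csInf_mem_closure hSne hSbdd) o ho hxo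
  have : 0 < g y := hosub ⟨hyo, csInf_le hSbdd hyS⟩
  exact lt_asymm this hyS.2

lemma setIntegral_Ioc_sub_setIntegral_Ioc {P : Measure ℝ} {a s t : ℝ} {u : ℝ → ℝ}
    (hu : Integrable u P) (has : a ≤ s) (hst : s ≤ t) :
    (∫ r in Ioc a t, u r ∂P) - ∫ r in Ioc a s, u r ∂P = ∫ r in Ioc s t, u r ∂P := by
  rw [← Ioc_union_Ioc_eq_Ioc has hst, setIntegral_union (Ioc_disjoint_Ioc_of_le le_rfl)
    measurableSet_Ioc hu.integrableOn hu.integrableOn, add_sub_cancel_left]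

/-- if `min f > ν₊([x₀,x₁])²` then `u'' + uν - uf = 0` has a positive
non-decreasing solution on `[x₀, x₁]`.  Here `νp ⟂ νm`, so `νp` is the positive part of `ν`. -/
theorem exists_pos_monotone_solution
    (I : Set ℝ) (hIopen : IsOpen I) (hIconn : I.OrdConnected)
    (νp νm : Measure ℝ) (hsing : νp.MutuallySingular νm)
    (hνp : ∀ x ∈ I, ∀ y ∈ I, νp (Icc x y) < ⊤)
    (hνm : ∀ x ∈ I, ∀ y ∈ I, νm (Icc x y) < ⊤)
    (x₀ x₁ : ℝ) (hx₀ : x₀ ∈ I) (hx₁ : x₁ ∈ I) (h01 : x₀ < x₁)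
    (f : ℝ → ℝ) (hfcont : ContinuousOn f (Icc x₀ x₁))
    (hfpos : ∀ x ∈ Icc x₀ x₁, 0 < f x)
    (hfmin : ∀ x ∈ Icc x₀ x₁, ((νp (Icc x₀ x₁)).toReal) ^ 2 < f x) :
    ∃ u g : ℝ → ℝ, IsSolutionSMF x₀ x₁ νp νm f u g ∧
      (∀ x ∈ Icc x₀ x₁, 0 < u x) ∧ MonotoneOn u (Icc x₀ x₁) := by
  have hIoc : ∀ {s t}, s ∈ Icc x₀ x₁ → t ∈ Icc x₀ x₁ → Ioc s t ⊆ Ioc x₀ x₁ :=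
    fun hs ht => Ioc_subset_Ioc hs.1 ht.2
  set J := Ioc x₀ x₁
  have hfinp : IsFiniteMeasure (νp.restrict J) := isFiniteMeasure_restrict.2
    ((measure_mono Ioc_subset_Icc_self).trans_lt (hνp x₀ hx₀ x₁ hx₁)).ne
  have hfinm : IsFiniteMeasure (νm.restrict J) := isFiniteMeasure_restrict.2
    ((measure_mono Ioc_subset_Icc_self).trans_lt (hνm x₀ hx₀ x₁ hx₁)).ne
  have hfint : IntegrableOn f J := (hfcont.integrableOn_Icc).mono_set Ioc_subset_Icc_self
  set φ := (volume.restrict J).withDensity fun t => ENNReal.ofReal (f t) with hφ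
  have hfinf : IsFiniteMeasure φ := isFiniteMeasure_withDensity_ofReal hfint.2
  obtain ⟨z, hz, hzmin⟩ := isCompact_Icc.exists_isMinOn (nonempty_Icc.2 h01.le) hfcont
  set M := (νp (Icc x₀ x₁)).toReal
  have hM : 0 ≤ M := ENNReal.toReal_nonneg
  have hL2 : √(f z) ^ 2 = f z := Real.sq_sqrt (hfpos z hz).le
  have hML : M < √(f z) := (Real.lt_sqrt hM).2 (hfmin z hz)
  obtain ⟨u, hu, ⟨B, hB⟩, hueq⟩ := exists_solution_integral_equation
    (νp.restrict J) (νm.restrict J + φ) h01.le √(f z)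
  set g := rightDerivSMF (νp.restrict J) (νm.restrict J + φ) x₀ √(f z) u with hg
  have huint (P : Measure ℝ) [IsFiniteMeasure P] : Integrable u P :=
    .of_bound hu.aestronglyMeasurable B (.of_forall hB)
  have hgint (x y : ℝ) : IntervalIntegrable g volume x y :=
    intervalIntegrable_rightDerivSMF _ _ _ _ hu hB x y
  have hgcont (x : ℝ) : ContinuousWithinAt g (Ici x) x :=
    (continuousWithinAt_const.sub (continuousWithinAt_setIntegral_Ioc _ _ _ (huint _))).add
      (continuousWithinAt_setIntegral_Ioc _ _ _ (huint _))
  have hug : ∀ s ∈ Icc x₀ x₁, ∀ t ∈ Icc x₀ x₁, u t - u s = ∫ r in s..t, g r := by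
    intro s hs t ht
    rw [hueq s hs, hueq t ht, add_sub_add_left_eq_sub]
    exact intervalIntegral.integral_interval_sub_left (hgint _ _) (hgint _ _)
  have hgdiff : ∀ s ∈ Icc x₀ x₁, ∀ t ∈ Icc x₀ x₁, s ≤ t →
      g t - g s = -((∫ r in Ioc s t, u r ∂νp) - ∫ r in Ioc s t, u r ∂νm)
        + ∫ r in s..t, u r * f r := by
    intro s hs t ht hst
    have hP := setIntegral_Ioc_sub_setIntegral_Ioc (huint (νp.restrict J)) hs.1 hst
    have hQ := setIntegral_Ioc_sub_setIntegral_Ioc (huint (νm.restrict J + φ)) hs.1 hst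
    rw [Measure.restrict_restrict_of_subset (hIoc hs ht)] at hP
    have hadd : ∫ r in Ioc s t, u r ∂(νm.restrict J + φ)
        = (∫ r in Ioc s t, u r ∂νm) + ∫ r in Ioc s t, u r ∂φ := by
      rw [Measure.restrict_add, integral_add_measure (huint _) (huint _),
        Measure.restrict_restrict_of_subset (hIoc hs ht)]
    have hf : ∫ r in Ioc s t, u r ∂φ = ∫ r in s..t, u r * f r := by
      rw [hφ, restrict_withDensity measurableSet_Ioc,
        Measure.restrict_restrict_of_subset (hIoc hs ht),
        integral_withDensity_eq_integral_toReal_smul₀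
          (hfint.mono_set (hIoc hs ht)).aemeasurable.ennreal_ofReal
          (.of_forall fun _ => ENNReal.ofReal_lt_top),
        intervalIntegral.integral_of_le hst]
      refine setIntegral_congr_fun measurableSet_Ioc fun r hr => ?_
      have hr' : r ∈ Icc x₀ x₁ := Ioc_subset_Icc_self (hIoc hs ht hr)
      simp [ENNReal.toReal_ofReal (hfpos r hr').le, mul_comm]
    simp only [hg, rightDerivSMF]
    linarith
  have hua : u x₀ = 1 := by simpa using hueq x₀ (left_mem_Icc.2 h01.le)
  have hgnn : ∀ x ∈ Icc x₀ x₁, 0 ≤ g x := by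
    refine nonneg_of_rightDeriv_lower_bound hM hML hu hgint hua hug
      (by simp [hg, rightDerivSMF]) hgcont fun x hx hux t ht => ?_
    have htx : t ∈ Icc x₀ x₁ := ⟨ht.1, ht.2.trans hx.2⟩
    have hu1 : ∀ s ∈ Icc t x, 1 ≤ u s ∧ u s ≤ u x := fun s hs => hux s ⟨ht.1.trans hs.1, hs.2⟩
    rw [hgdiff t htx x hx ht.2]
    have hp : ∫ r in Ioc t x, u r ∂νp ≤ M * u x := by
      have hsub : Ioc t x ⊆ Icc x₀ x₁ := (hIoc htx hx).trans Ioc_subset_Icc_self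
      have hlt : νp (Icc x₀ x₁) < ⊤ := hνp x₀ hx₀ x₁ hx₁
      have hnorm : ∀ r ∈ Ioc t x, ‖u r‖ ≤ u x := fun r hr => by
        have := hu1 r (Ioc_subset_Icc_self hr)
        rw [Real.norm_of_nonneg (by linarith)]
        exact this.2
      refine (le_abs_self _).trans ((norm_setIntegral_le_of_norm_le_const
        ((measure_mono hsub).trans_lt hlt) hnorm).trans ?_)
      rw [mul_comm]
      exact mul_le_mul_of_nonneg_right (ENNReal.toReal_mono hlt.ne (measure_mono hsub))
        (zero_le_one.trans (hux x (right_mem_Icc.2 hx.1)).1)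
    have hm : 0 ≤ ∫ r in Ioc t x, u r ∂νm := setIntegral_nonneg measurableSet_Ioc fun r hr =>
      zero_le_one.trans (hu1 r (Ioc_subset_Icc_self hr)).1
    have hf : √(f z) ^ 2 * (∫ s in t..x, u s) ≤ ∫ r in t..x, u r * f r := by
      rw [hL2, ← intervalIntegral.integral_const_mul]
      refine intervalIntegral.integral_mono_on ht.2
        (Continuous.intervalIntegrable (by fun_prop) _ _) ?_ fun s hs => ?_
      · refine ContinuousOn.intervalIntegrable_of_Icc ht.2 (hu.continuousOn.mul ?_)
        exact hfcont.mono (Icc_subset_Icc ht.1 hx.2)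
      · rw [mul_comm]
        exact mul_le_mul_of_nonneg_left (hzmin ⟨ht.1.trans hs.1, hs.2.trans hx.2⟩)
          (zero_le_one.trans (hu1 s hs).1)
    linarith
  have hmono : MonotoneOn u (Icc x₀ x₁) := fun s hs t ht hst => by
    rw [← sub_nonneg, hug s hs t ht]
    exact intervalIntegral.integral_nonneg hst fun r hr => hgnn r ⟨hs.1.trans hr.1, hr.2.trans ht.2⟩
  refine ⟨u, g, ⟨hu.continuousOn, fun x _ => hgcont x, fun s hs t ht => ?_, hgdiff⟩,
    fun x hx => ?_, hmono⟩
  · linarith [hug s hs t ht]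
  · linarith [hmono (left_mem_Icc.2 h01.le) hx hx.1]
end

section
/- Let I be an open interval of ℝ with [0, +∞) ⊆ I and let κ be a nonzero positive Radon measure on I. Let u↑ be a solution of (1/2)u″ = uκ on I that is positive and non-decreasing, and let u↓ be a solution that is positive and non-increasing (the limits of u↓ at +∞ and of u↑ at −inf I exist by monotonicity). Then the following four conditions are equivalent: (i) ∫_{(0,+∞)} x κ(dx) < +∞; (ii) lim_{x→+∞} u↓(x) > 0; (iii) there is C > 0 such that u↑(x) ≤ C·x for all x ≥ 1; (iv) ∫_{(0,+∞)} u↑(x)·u↓(x) κ(dx) < +∞. -/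
open MeasureTheory Set Filter

/-- `u` is a solution of `(1/2) u'' = u κ` on `I`, where `κ` is a positive Radon
measure, and `g` is the right-continuous right-derivative of `u`. -/
def IsSolKappa (I : Set ℝ) (κ : Measure ℝ) (u g : ℝ → ℝ) : Prop :=
  ContinuousOn u I ∧
  (∀ x ∈ I, ContinuousWithinAt g (Ici x) x) ∧
  (∀ x' ∈ I, ∀ x ∈ I, u x = u x' + ∫ t in x'..x, g t) ∧
  (∀ x' ∈ I, ∀ x ∈ I, x' ≤ x → g x - g x' = 2 * ∫ t in Ioc x' x, u t ∂κ)

/-- Integration by parts: the integral of `h` against the increments of a primitive of `f`. -/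
theorem setIntegral_mul_intervalIntegral_eq {κ : Measure ℝ} {a x : ℝ} (hax : a ≤ x)
    (hκ : κ (Ioc a x) < ⊤) {f h : ℝ → ℝ} (hf : IntervalIntegrable f volume a x)
    (hh : IntegrableOn h (Ioc a x) κ) :
    ∫ t in Ioc a x, h t * (∫ s in t..x, f s) ∂κ =
      ∫ s in a..x, f s * ∫ t in Ioc a s, h t ∂κ := by
  have : IsFiniteMeasure (κ.restrict (Ioc a x)) := ⟨by simpa using hκ⟩
  have hf' : IntegrableOn f (Ioc a x) volume :=
    (intervalIntegrable_iff_integrableOn_Ioc_of_le hax).1 hf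
  set k : ℝ → ℝ → ℝ := fun t s => {p : ℝ × ℝ | p.1 ≤ p.2}.indicator (fun p => h p.1 * f p.2) (t, s)
    with hk
  have hkint : Integrable (Function.uncurry k)
      ((κ.restrict (Ioc a x)).prod (volume.restrict (Ioc a x))) :=
    (Integrable.mul_prod hh hf').indicator (measurableSet_le measurable_fst measurable_snd)
  have hswap := integral_integral_swap hkint
  rw [intervalIntegral.integral_of_le hax]
  refine Eq.trans ?_ (hswap.trans ?_)
  · refine setIntegral_congr_fun measurableSet_Ioc fun t ht => ?_
    have h1 : ∀ s, k t s = h t * (Ici t).indicator f s := fun s => by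
      by_cases hs : t ≤ s <;> simp [hk, hs]
    simp only [h1]
    rw [integral_const_mul, intervalIntegral.integral_of_le ht.2,
      ← integral_Icc_eq_integral_Ioc, setIntegral_indicator measurableSet_Ici]
    congr 3
    ext s
    simp only [mem_Icc, mem_inter_iff, mem_Ioc, mem_Ici]
    exact ⟨fun hs => ⟨⟨ht.1.trans_le hs.1, hs.2⟩, hs.1⟩, fun hs => ⟨hs.2, hs.1.2⟩⟩
  · refine setIntegral_congr_fun measurableSet_Ioc fun s hs => ?_
    have h1 : ∀ t, k t s = f s * (Iic s).indicator h t := fun t => by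
      by_cases hs : t ≤ s <;> simp [hk, hs, mul_comm]
    simp only [h1]
    rw [integral_const_mul, setIntegral_indicator measurableSet_Iic]
    congr 3
    ext t
    simp only [mem_inter_iff, mem_Ioc, mem_Iic]
    exact ⟨fun ht => ⟨ht.1.1, ht.2⟩, fun ht => ⟨⟨ht.1, ht.2.trans hs.2⟩, ht.2⟩⟩

theorem ContinuousOn.integrableOn_Ioc_of_measure_Icc_lt_top_s5 {κ : Measure ℝ} {a x : ℝ}
    (hκ : κ (Icc a x) < ⊤) {f : ℝ → ℝ} (hf : ContinuousOn f (Icc a x)) :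
    IntegrableOn f (Ioc a x) κ := by
  obtain ⟨C, hC⟩ := isCompact_Icc.exists_bound_of_continuousOn hf
  refine IntegrableOn.mono_set ?_ Ioc_subset_Icc_self
  have : IsFiniteMeasure (κ.restrict (Icc a x)) := ⟨by simpa using hκ⟩
  exact Integrable.of_bound (hf.aestronglyMeasurable measurableSet_Icc) C
    ((ae_restrict_iff' measurableSet_Icc).2 (Eventually.of_forall hC))

namespace IsSolKappa

theorem integrableOn {I : Set ℝ} {κ : Measure ℝ} {u g : ℝ → ℝ} (h : IsSolKappa I κ u g)
    (hI : I.OrdConnected) (hκ : ∀ x ∈ I, ∀ y ∈ I, κ (Icc x y) < ⊤) {a x : ℝ}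
    (ha : a ∈ I) (hx : x ∈ I) : IntegrableOn u (Ioc a x) κ :=
  (h.1.mono (hI.out ha hx)).integrableOn_Ioc_of_measure_Icc_lt_top_s5 (hκ a ha x hx)

theorem monotoneOn_deriv {I : Set ℝ} {κ : Measure ℝ} {u g : ℝ → ℝ} (h : IsSolKappa I κ u g)
    (hI : I.OrdConnected) (hu : ∀ x ∈ I, 0 ≤ u x) : MonotoneOn g I := by
  intro a ha x hx hax
  have h1 := h.2.2.2 a ha x hx hax
  have h2 : 0 ≤ ∫ t in Ioc a x, u t ∂κ :=
    setIntegral_nonneg measurableSet_Ioc fun t ht => hu t (hI.out ha hx (Ioc_subset_Icc_self ht))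
  linarith

theorem intervalIntegrable_deriv {I : Set ℝ} {κ : Measure ℝ} {u g : ℝ → ℝ}
    (h : IsSolKappa I κ u g) (hI : I.OrdConnected) (hu : ∀ x ∈ I, 0 ≤ u x) {a x : ℝ}
    (ha : a ∈ I) (hx : x ∈ I) : IntervalIntegrable g volume a x :=
  ((h.monotoneOn_deriv hI hu).mono (hI.uIcc_subset ha hx)).intervalIntegrable

theorem deriv_mul_le_sub {I : Set ℝ} {κ : Measure ℝ} {u g : ℝ → ℝ} (h : IsSolKappa I κ u g)
    (hI : I.OrdConnected) (hu : ∀ x ∈ I, 0 ≤ u x) {a x : ℝ} (ha : a ∈ I) (hx : x ∈ I)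
    (hax : a ≤ x) : g a * (x - a) ≤ u x - u a := by
  have h1 := h.2.2.1 a ha x hx
  have h2 : ∫ _ in a..x, g a ≤ ∫ t in a..x, g t :=
    intervalIntegral.integral_mono_on hax intervalIntegrable_const
      (h.intervalIntegrable_deriv hI hu ha hx) fun t ht =>
        h.monotoneOn_deriv hI hu ha (hI.out ha hx ht) ht.1
  rw [intervalIntegral.integral_const, smul_eq_mul] at h2
  linarith

theorem sub_le_deriv_mul {I : Set ℝ} {κ : Measure ℝ} {u g : ℝ → ℝ} (h : IsSolKappa I κ u g)
    (hI : I.OrdConnected) (hu : ∀ x ∈ I, 0 ≤ u x) {a x : ℝ} (ha : a ∈ I) (hx : x ∈ I)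
    (hax : a ≤ x) : u x - u a ≤ g x * (x - a) := by
  have h1 := h.2.2.1 a ha x hx
  have h2 : ∫ t in a..x, g t ≤ ∫ _ in a..x, g x :=
    intervalIntegral.integral_mono_on hax (h.intervalIntegrable_deriv hI hu ha hx)
      intervalIntegrable_const fun t ht =>
        h.monotoneOn_deriv hI hu (hI.out ha hx ht) hx ht.2
  rw [intervalIntegral.integral_const, smul_eq_mul] at h2
  linarith

/-- Product rule for a primitive `v` of `f` and the right-derivative `g` of a solution. -/
theorem mul_deriv_sub {I : Set ℝ} {κ : Measure ℝ} {u g : ℝ → ℝ} (h : IsSolKappa I κ u g)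
    (hI : I.OrdConnected) (hκ : ∀ x ∈ I, ∀ y ∈ I, κ (Icc x y) < ⊤)
    {v f : ℝ → ℝ} {a x : ℝ} (ha : a ∈ I) (hx : x ∈ I) (hax : a ≤ x)
    (hf : IntervalIntegrable f volume a x) (hvc : ContinuousOn v I)
    (hv : ∀ t ∈ I, v x = v t + ∫ s in t..x, f s)
    (hfg : IntervalIntegrable (fun s => f s * g s) volume a x) :
    v x * g x - v a * g a = 2 * ∫ t in Ioc a x, v t * u t ∂κ + ∫ s in a..x, f s * g s := by
  have hsub := hI.out ha hx
  have hint := h.integrableOn hI hκ ha hx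
  have hvint : IntegrableOn (fun t => v t * u t) (Ioc a x) κ :=
    ((hvc.mul h.1).mono hsub).integrableOn_Ioc_of_measure_Icc_lt_top_s5 (hκ a ha x hx)
  have h1 := setIntegral_mul_intervalIntegral_eq hax
    ((measure_mono Ioc_subset_Icc_self).trans_lt (hκ a ha x hx)) hf hint
  have h2 : ∫ t in Ioc a x, u t * (∫ s in t..x, f s) ∂κ =
      v x * (∫ t in Ioc a x, u t ∂κ) - ∫ t in Ioc a x, v t * u t ∂κ := by
    rw [← integral_const_mul, ← integral_sub (hint.const_mul _) hvint]
    refine setIntegral_congr_fun measurableSet_Ioc fun t ht => ?_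
    have := hv t (hsub (Ioc_subset_Icc_self ht))
    rw [this]
    ring
  have h3 : ∫ s in a..x, f s * ∫ t in Ioc a s, u t ∂κ =
      (1 / 2) * ((∫ s in a..x, f s * g s) - g a * ∫ s in a..x, f s) := by
    rw [← intervalIntegral.integral_const_mul, ← intervalIntegral.integral_sub hfg (hf.const_mul _),
      ← intervalIntegral.integral_const_mul]
    refine intervalIntegral.integral_congr fun s hs => ?_
    rw [uIcc_of_le hax] at hs
    have := h.2.2.2 a ha s (hsub hs) hs.1
    linear_combination (-f s / 2) * this
  have h4 := h.2.2.2 a ha x hx hax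
  have h5 := hv a ha
  rw [h2, h3] at h1
  linear_combination v x * h4 + 2 * h1 + g a * h5

theorem wronskian_eq {I : Set ℝ} {κ : Measure ℝ} {u g v f : ℝ → ℝ} (h : IsSolKappa I κ u g)
    (h' : IsSolKappa I κ v f) (hI : I.OrdConnected) (hκ : ∀ x ∈ I, ∀ y ∈ I, κ (Icc x y) < ⊤)
    (hu : ∀ x ∈ I, 0 ≤ u x) (hv : ∀ x ∈ I, 0 ≤ v x) {a x : ℝ} (ha : a ∈ I) (hx : x ∈ I)
    (hax : a ≤ x) : v x * g x - u x * f x = v a * g a - u a * f a := by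
  have hg := h.intervalIntegrable_deriv hI hu ha hx
  have hf := h'.intervalIntegrable_deriv hI hv ha hx
  have hgb : ∀ t ∈ Icc a x, ‖g t‖ ≤ |g a| + |g x| := fun t ht => by
    have hm := h.monotoneOn_deriv hI hu
    have h1 := hm ha (hI.out ha hx ht) ht.1
    have h2 := hm (hI.out ha hx ht) hx ht.2
    rw [Real.norm_eq_abs, abs_le]
    constructor
    · linarith [neg_abs_le (g a), abs_nonneg (g x)]
    · linarith [le_abs_self (g x), abs_nonneg (g a)]
  have hfg : IntervalIntegrable (fun s => f s * g s) volume a x := by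
    rw [intervalIntegrable_iff_integrableOn_Ioc_of_le hax] at hf hg ⊢
    exact Integrable.mul_bdd hf hg.aestronglyMeasurable
      ((ae_restrict_iff' measurableSet_Ioc).2
        (Eventually.of_forall fun t ht => hgb t (Ioc_subset_Icc_self ht)))
  have h1 := h.mul_deriv_sub hI hκ ha hx hax hf h'.1 (fun t ht => h'.2.2.1 t ht x hx) hfg
  have h2 := h'.mul_deriv_sub hI hκ ha hx hax hg h.1 (fun t ht => h.2.2.1 t ht x hx)
    (by simpa only [mul_comm] using hfg)
  simp only [mul_comm (u _) (v _), mul_comm (g _) (f _)] at h1 h2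
  linarith

end IsSolKappa

theorem setLIntegral_Ioi_lt_top_iff {κ : Measure ℝ} {p : ℝ → ℝ} (hp : ∀ t, 0 < t → 0 ≤ p t)
    (hint : ∀ x, 0 < x → IntegrableOn p (Ioc 0 x) κ) :
    (∫⁻ t in Ioi (0 : ℝ), ENNReal.ofReal (p t) ∂κ) < ⊤ ↔
      ∃ M, ∀ x, 0 < x → ∫ t in Ioc 0 x, p t ∂κ ≤ M := by
  have key : ∀ x, 0 < x → ENNReal.ofReal (∫ t in Ioc 0 x, p t ∂κ) =
      ∫⁻ t in Ioc 0 x, ENNReal.ofReal (p t) ∂κ := fun x hx =>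
    ofReal_integral_eq_lintegral_ofReal (hint x hx)
      ((ae_restrict_iff' measurableSet_Ioc).2 (Eventually.of_forall fun t ht => hp t ht.1))
  constructor
  · intro h
    refine ⟨(∫⁻ t in Ioi (0 : ℝ), ENNReal.ofReal (p t) ∂κ).toReal, fun x hx => ?_⟩
    rw [← ENNReal.ofReal_le_iff_le_toReal h.ne, key x hx]
    exact lintegral_mono_set Ioc_subset_Ioi_self
  · rintro ⟨M, hM⟩
    have hU : Ioi (0 : ℝ) = ⋃ n : ℕ, Ioc (0 : ℝ) ((n : ℝ) + 1) := by
      ext t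
      simp only [mem_Ioi, mem_iUnion, mem_Ioc]
      refine ⟨fun ht => ?_, fun ⟨_, h⟩ => h.1⟩
      obtain ⟨n, hn⟩ := exists_nat_ge t
      exact ⟨n, ht, by linarith⟩
    rw [hU, setLIntegral_iUnion_of_directed]
    · refine (iSup_le fun n => ?_).trans_lt (ENNReal.ofReal_lt_top (r := M))
      rw [← key _ (by positivity)]
      exact ENNReal.ofReal_le_ofReal (hM _ (by positivity))
    · refine Monotone.directed_le fun m n hmn => Ioc_subset_Ioc_right ?_
      gcongr

theorem eventually_setIntegral_Ioc_le {κ : Measure ℝ} {p : ℝ → ℝ} (hp : ∀ t, 0 < t → 0 ≤ p t)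
    (hint : ∀ x, 0 < x → IntegrableOn p (Ioc 0 x) κ)
    (hM : ∃ M, ∀ x, 0 < x → ∫ t in Ioc 0 x, p t ∂κ ≤ M) {ε : ℝ} (hε : 0 < ε) :
    ∀ᶠ a in atTop, ∀ x, a ≤ x → ∫ t in Ioc a x, p t ∂κ ≤ ε := by
  obtain ⟨M, hM⟩ := hM
  have hadd : ∀ a x, 0 < a → a ≤ x → ∫ t in Ioc 0 x, p t ∂κ =
      ∫ t in Ioc 0 a, p t ∂κ + ∫ t in Ioc a x, p t ∂κ := fun a x ha hax => by
    rw [← Ioc_union_Ioc_eq_Ioc ha.le hax]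
    exact setIntegral_union (Ioc_disjoint_Ioc_of_le le_rfl) measurableSet_Ioc (hint a ha)
      ((hint x (ha.trans_le hax)).mono_set (Ioc_subset_Ioc_left ha.le))
  set S : Set ℝ := (fun x => ∫ t in Ioc 0 x, p t ∂κ) '' Ioi 0 with hS
  have hne : S.Nonempty := ⟨_, 1, mem_Ioi.2 one_pos, rfl⟩
  have hbdd : BddAbove S := ⟨M, by rintro _ ⟨x, hx, rfl⟩; exact hM x hx⟩
  obtain ⟨_, ⟨b, hb, rfl⟩, hlt⟩ := exists_lt_of_lt_csSup hne (sub_lt_self (sSup S) hε)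
  filter_upwards [eventually_ge_atTop b] with a hba x hax
  have hb : 0 < b := hb
  have ha : 0 < a := hb.trans_le hba
  have h1 : ∫ t in Ioc 0 x, p t ∂κ ≤ sSup S := le_csSup hbdd ⟨x, ha.trans_le hax, rfl⟩
  have h2 := hadd a x ha hax
  have h3 := hadd b a hb hba
  have h4 : 0 ≤ ∫ t in Ioc b a, p t ∂κ :=
    setIntegral_nonneg measurableSet_Ioc fun t ht => hp t (hb.trans ht.1)
  simp only at hlt
  linarith

namespace IsSolKappa

theorem deriv_nonpos {I : Set ℝ} {κ : Measure ℝ} {u g : ℝ → ℝ} (h : IsSolKappa I κ u g)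
    (hI : I.OrdConnected) (hI0 : Ici (0 : ℝ) ⊆ I) (hu : ∀ x ∈ I, 0 ≤ u x)
    (hanti : AntitoneOn u I) {x : ℝ} (hx : 0 ≤ x) : g x ≤ 0 := by
  have h1 := h.deriv_mul_le_sub hI hu (hI0 hx) (hI0 (show (0 : ℝ) ≤ x + 1 by linarith))
    (by linarith : x ≤ x + 1)
  have h2 := hanti (hI0 hx) (hI0 (show (0 : ℝ) ≤ x + 1 by linarith)) (by linarith)
  linarith

theorem deriv_nonneg {I : Set ℝ} {κ : Measure ℝ} {u g : ℝ → ℝ} (h : IsSolKappa I κ u g)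
    (hIo : IsOpen I) (hI : I.OrdConnected) (hI0 : Ici (0 : ℝ) ⊆ I) (hu : ∀ x ∈ I, 0 ≤ u x)
    (hmono : MonotoneOn u I) {x : ℝ} (hx : 0 ≤ x) : 0 ≤ g x := by
  obtain ⟨ε, hε, hball⟩ := Metric.isOpen_iff.1 hIo x (hI0 hx)
  have hy : x - ε / 2 ∈ I := hball (by
    rw [Metric.mem_ball, Real.dist_eq, abs_lt]
    constructor <;> linarith)
  have h1 := h.sub_le_deriv_mul hI hu hy (hI0 hx) (by linarith)
  have h2 := hmono hy (hI0 hx) (by linarith)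
  nlinarith

theorem setIntegral_id_mul {I : Set ℝ} {κ : Measure ℝ} {u g : ℝ → ℝ} (h : IsSolKappa I κ u g)
    (hI : I.OrdConnected) (hI0 : Ici (0 : ℝ) ⊆ I) (hκ : ∀ x ∈ I, ∀ y ∈ I, κ (Icc x y) < ⊤)
    (hu : ∀ x ∈ I, 0 ≤ u x) {x : ℝ} (hx : 0 ≤ x) :
    2 * ∫ t in Ioc 0 x, t * u t ∂κ = x * g x - u x + u 0 := by
  have hz : (0 : ℝ) ∈ I := hI0 self_mem_Ici
  have h1 := h.mul_deriv_sub hI hκ (v := fun t => t) (f := fun _ => 1) hz (hI0 hx) hx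
    intervalIntegrable_const continuousOn_id (by intro t _; simp)
    (by simpa using h.intervalIntegrable_deriv hI hu hz (hI0 hx))
  have h2 := h.2.2.1 0 hz x (hI0 hx)
  simp only [one_mul] at h1
  linarith

theorem exists_le_mul_of_setIntegral_le {I : Set ℝ} {κ : Measure ℝ} {u g : ℝ → ℝ}
    (h : IsSolKappa I κ u g)
    (hIo : IsOpen I) (hI : I.OrdConnected) (hI0 : Ici (0 : ℝ) ⊆ I)
    (hκ : ∀ x ∈ I, ∀ y ∈ I, κ (Icc x y) < ⊤) (hu : ∀ x ∈ I, 0 < u x) (hmono : MonotoneOn u I)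
    (hM : ∃ M, ∀ x, 0 < x → ∫ t in Ioc 0 x, t ∂κ ≤ M) :
    ∃ C : ℝ, 0 < C ∧ ∀ x : ℝ, 1 ≤ x → u x ≤ C * x := by
  have hu' : ∀ x ∈ I, 0 ≤ u x := fun x hx => (hu x hx).le
  have hz : (0 : ℝ) ∈ I := hI0 self_mem_Ici
  have hid : ∀ a x, 0 ≤ a → 0 ≤ x → IntegrableOn (fun t : ℝ => t) (Ioc a x) κ := fun a x ha hx =>
    continuousOn_id.integrableOn_Ioc_of_measure_Icc_lt_top_s5 (hκ a (hI0 ha) x (hI0 hx))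
  obtain ⟨a, htail, ha⟩ := ((eventually_setIntegral_Ioc_le (p := fun t : ℝ => t)
    (fun t ht => ht.le) (fun x hx => hid 0 x le_rfl hx.le) hM
    (by norm_num : (0 : ℝ) < 1 / 4)).and (eventually_ge_atTop 1)).exists
  have ha0 : (0 : ℝ) ≤ a := by linarith
  have hbound : ∀ x, a ≤ x → g x ≤ 2 * g a + u a := fun x hax => by
    have hx : 0 ≤ x := ha0.trans hax
    have hgx := h.deriv_nonneg hIo hI hI0 hu' hmono hx
    have hua := hu' a (hI0 ha0)
    have h1 := h.2.2.2 a (hI0 ha0) x (hI0 hx) hax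
    have h2 : ∫ t in Ioc a x, u t ∂κ ≤ ∫ t in Ioc a x, (u a + g x) * t ∂κ := by
      refine setIntegral_mono_on (h.integrableOn hI hκ (hI0 ha0) (hI0 hx))
        ((hid a x ha0 hx).const_mul _) measurableSet_Ioc fun t ht => ?_
      have ht0 : (0 : ℝ) ≤ t := ha0.trans ht.1.le
      have h3 := h.sub_le_deriv_mul hI hu' (hI0 ha0) (hI0 ht0) ht.1.le
      have h4 := h.monotoneOn_deriv hI hu' (hI0 ht0) (hI0 hx) ht.2
      have h5 : g t * (t - a) ≤ g x * t :=
        mul_le_mul h4 (by linarith) (by linarith [ht.1]) hgx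
      nlinarith [ht.1]
    rw [integral_const_mul] at h2
    have h6 := mul_le_mul_of_nonneg_left (htail x hax) (add_nonneg hua hgx)
    linarith
  have hga := h.deriv_nonneg hIo hI hI0 hu' hmono ha0
  have hua := hu' a (hI0 ha0)
  have hu0 := hu 0 hz
  refine ⟨u 0 + (2 * g a + u a), by linarith, fun x hx => ?_⟩
  have hx0 : (0 : ℝ) ≤ x := by linarith
  have hgx : g x ≤ 2 * g a + u a := (le_total a x).elim (hbound x) fun hxa =>
    (h.monotoneOn_deriv hI hu' (hI0 hx0) (hI0 ha0) hxa).trans (by linarith)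
  have h1 := h.sub_le_deriv_mul hI hu' hz (hI0 hx0) hx0
  have h2 := mul_le_mul_of_nonneg_right hgx hx0
  nlinarith

theorem deriv_le_of_le_mul {I : Set ℝ} {κ : Measure ℝ} {u g : ℝ → ℝ} (h : IsSolKappa I κ u g)
    (hI : I.OrdConnected) (hI0 : Ici (0 : ℝ) ⊆ I) (hu : ∀ x ∈ I, 0 ≤ u x) {C : ℝ}
    (hC : ∀ x : ℝ, 1 ≤ x → u x ≤ C * x) {x : ℝ} (hx : 0 ≤ x) : g x ≤ 2 * C := by
  have key : ∀ y : ℝ, 1 ≤ y → g y ≤ 2 * C := fun y hy => by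
    have hy0 : (0 : ℝ) ≤ y := by linarith
    have hy2 : (0 : ℝ) ≤ 2 * y := by linarith
    have h1 := h.deriv_mul_le_sub hI hu (hI0 hy0) (hI0 hy2) (by linarith)
    have h2 := hC (2 * y) (by linarith)
    have h3 := hu y (hI0 hy0)
    exact le_of_mul_le_mul_right (by nlinarith) (by linarith : (0 : ℝ) < y)
  exact (h.monotoneOn_deriv hI hu (hI0 hx) (hI0 (show (0 : ℝ) ≤ x + 1 by linarith))
    (by linarith)).trans (key (x + 1) (by linarith))

theorem tendsto_deriv_zero {I : Set ℝ} {κ : Measure ℝ} {u g : ℝ → ℝ} (h : IsSolKappa I κ u g)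
    (hI : I.OrdConnected) (hI0 : Ici (0 : ℝ) ⊆ I) (hu : ∀ x ∈ I, 0 ≤ u x)
    (hanti : AntitoneOn u I) : Tendsto g atTop (nhds 0) := by
  have hlim : Tendsto (fun x : ℝ => -u 0 / x) atTop (nhds 0) :=
    tendsto_const_nhds.div_atTop tendsto_id
  refine tendsto_of_tendsto_of_tendsto_of_le_of_le' hlim tendsto_const_nhds ?_ ?_
  · filter_upwards [eventually_gt_atTop 0] with x hx
    have h1 := h.sub_le_deriv_mul hI hu (hI0 self_mem_Ici) (hI0 hx.le) hx.le
    have h2 := hu x (hI0 hx.le)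
    rw [div_le_iff₀ hx]
    linarith
  · filter_upwards [eventually_ge_atTop 0] with x hx
    exact h.deriv_nonpos hI hI0 hu hanti hx

theorem exists_tendsto_pos {I : Set ℝ} {κ : Measure ℝ} {u g v f : ℝ → ℝ}
    (h : IsSolKappa I κ u g) (h' : IsSolKappa I κ v f)
    (hI : I.OrdConnected) (hI0 : Ici (0 : ℝ) ⊆ I)
    (hκ : ∀ x ∈ I, ∀ y ∈ I, κ (Icc x y) < ⊤) (hu : ∀ x ∈ I, 0 < u x) (hmono : MonotoneOn u I)
    (hg : ∀ x, 0 ≤ x → 0 ≤ g x)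
    (hv : ∀ x ∈ I, 0 < v x) (hanti : AntitoneOn v I)
    (hM : ∃ M, ∀ x, 0 < x → ∫ t in Ioc 0 x, u t * v t ∂κ ≤ M) :
    ∃ l : ℝ, 0 < l ∧ Tendsto v atTop (nhds l) := by
  have hu' : ∀ x ∈ I, 0 ≤ u x := fun x hx => (hu x hx).le
  have hv' : ∀ x ∈ I, 0 ≤ v x := fun x hx => (hv x hx).le
  have hz : (0 : ℝ) ∈ I := hI0 self_mem_Ici
  have hint : ∀ a x, 0 ≤ a → 0 ≤ x → IntegrableOn (fun t => u t * v t) (Ioc a x) κ :=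
    fun a x ha hx => ((h.1.mul h'.1).mono
      (hI.out (hI0 ha) (hI0 hx))).integrableOn_Ioc_of_measure_Icc_lt_top_s5
        (hκ a (hI0 ha) x (hI0 hx))
  obtain ⟨l, hl⟩ : ∃ l, Tendsto v atTop (nhds l) := by
    have hw : Antitone fun x => v (max x 0) := fun x y hxy =>
      hanti (hI0 (mem_Ici.2 (le_max_right _ _))) (hI0 (mem_Ici.2 (le_max_right _ _))) (max_le_max_right 0 hxy)
    have hb : BddBelow (range fun x => v (max x 0)) :=
      ⟨0, by rintro _ ⟨x, rfl⟩; exact hv' _ (hI0 (mem_Ici.2 (le_max_right _ _)))⟩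
    refine ⟨_, (tendsto_atTop_ciInf hw hb).congr' ?_⟩
    filter_upwards [eventually_ge_atTop 0] with x hx
    rw [max_eq_left hx]
  have hl0 : 0 ≤ l := ge_of_tendsto hl (by
    filter_upwards [eventually_ge_atTop 0] with x hx using hv' x (hI0 hx))
  refine ⟨l, hl0.lt_of_ne' fun hlz => ?_, hl⟩
  rw [hlz] at hl
  have hW : v 0 * g 0 - u 0 * f 0 ≤ 0 := by
    refine le_of_forall_pos_le_add fun ε hε => ?_
    have hev := eventually_setIntegral_Ioc_le (p := fun t => u t * v t)
      (fun t ht => (mul_pos (hu t (hI0 (le_of_lt ht))) (hv t (hI0 (le_of_lt ht)))).le)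
      (fun x hx => hint 0 x le_rfl hx.le) hM (by positivity : 0 < ε / 5)
    have hA : ∀ᶠ a in atTop, -(u a * f a) ≤ 2 * (ε / 5) := by
      filter_upwards [hev, eventually_ge_atTop 0] with a htail ha
      have hlim : Tendsto (fun x => u a * (f x - f a)) atTop (nhds (u a * (0 - f a))) :=
        ((h'.tendsto_deriv_zero hI hI0 hv' hanti).sub_const _).const_mul _
      have := le_of_tendsto hlim (b := 2 * (ε / 5)) (by
        filter_upwards [eventually_ge_atTop a] with x hax
        have hx := ha.trans hax
        have h1 := h'.2.2.2 a (hI0 ha) x (hI0 hx) hax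
        have h2 : u a * ∫ t in Ioc a x, v t ∂κ ≤ ∫ t in Ioc a x, u t * v t ∂κ := by
          rw [← integral_const_mul]
          refine setIntegral_mono_on ((h'.integrableOn hI hκ (hI0 ha) (hI0 hx)).const_mul _)
            (hint a x ha hx) measurableSet_Ioc fun t ht => ?_
          have ht0 := hI0 (ha.trans ht.1.le)
          exact mul_le_mul_of_nonneg_right (hmono (hI0 ha) ht0 ht.1.le) (hv' t ht0)
        rw [h1]
        linarith [htail x hax])
      linarith
    obtain ⟨a, htail, ha⟩ := (hev.and (eventually_ge_atTop 0)).exists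
    have hlim : Tendsto (fun x => v x * g a) atTop (nhds 0) := by
      simpa using hl.mul_const (g a)
    obtain ⟨x, hxA, hax, hxlt⟩ := (hA.and ((eventually_ge_atTop a).and
      (hlim.eventually_lt_const (by positivity : 0 < ε / 5)))).exists
    have hx := ha.trans hax
    have h1 := h.2.2.2 a (hI0 ha) x (hI0 hx) hax
    have h2 : v x * ∫ t in Ioc a x, u t ∂κ ≤ ∫ t in Ioc a x, u t * v t ∂κ := by
      rw [← integral_const_mul]
      refine setIntegral_mono_on ((h.integrableOn hI hκ (hI0 ha) (hI0 hx)).const_mul _)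
        (hint a x ha hx) measurableSet_Ioc fun t ht => ?_
      have ht0 := hI0 (ha.trans ht.1.le)
      simp only [mul_comm (u t)]
      exact mul_le_mul_of_nonneg_right (hanti ht0 (hI0 hx) ht.2) (hu' t ht0)
    have h3 := h.wronskian_eq h' hI hκ hu' hv' hz (hI0 hx) hx
    have h4 : v x * g x = v x * g a + 2 * (v x * ∫ t in Ioc a x, u t ∂κ) := by
      linear_combination v x * h1
    linarith [htail x hax]
  have hf : ∀ x, 0 ≤ x → f x = 0 := fun x hx => by
    have h1 := h.wronskian_eq h' hI hκ hu' hv' hz (hI0 hx) hx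
    have h2 := mul_nonneg (hv' x (hI0 hx)) (hg x hx)
    have h3 := h'.deriv_nonpos hI hI0 hv' hanti hx
    have h4 := hu x (hI0 hx)
    by_contra hne
    have h5 := mul_neg_of_pos_of_neg h4 (lt_of_le_of_ne h3 hne)
    linarith
  have hge : v 0 ≤ 0 := ge_of_tendsto hl (by
    filter_upwards [eventually_ge_atTop 0] with x hx
    have h1 := h'.deriv_mul_le_sub hI hv' hz (hI0 hx) hx
    rw [hf 0 le_rfl] at h1
    linarith)
  exact absurd (hv 0 hz) hge.not_gt

end IsSolKappa

/-- for an open interval `I ⊇ [0,∞)` and a nonzero positive Radon measure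
`κ`, the four asymptotic conditions on `u↑`, `u↓` and `κ` are equivalent. -/
theorem tfae_asymptotics
    (I : Set ℝ) (hIopen : IsOpen I) (hIconn : I.OrdConnected)
    (hI0 : Ici (0 : ℝ) ⊆ I)
    (κ : Measure ℝ) (hκ0 : κ ≠ 0)
    (hκfin : ∀ x ∈ I, ∀ y ∈ I, κ (Icc x y) < ⊤)
    (uup udown gup gdown : ℝ → ℝ)
    (hup : IsSolKappa I κ uup gup) (hdown : IsSolKappa I κ udown gdown)
    (huppos : ∀ x ∈ I, 0 < uup x) (hupmono : MonotoneOn uup I)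
    (hdownpos : ∀ x ∈ I, 0 < udown x) (hdownanti : AntitoneOn udown I) :
    [(∫⁻ x in Ioi (0 : ℝ), ENNReal.ofReal x ∂κ) < ⊤,
     ∃ l : ℝ, 0 < l ∧ Tendsto udown atTop (nhds l),
     ∃ C : ℝ, 0 < C ∧ ∀ x : ℝ, 1 ≤ x → uup x ≤ C * x,
     (∫⁻ x in Ioi (0 : ℝ), ENNReal.ofReal (uup x * udown x) ∂κ) < ⊤].TFAE := by
  have hup' : ∀ x ∈ I, 0 ≤ uup x := fun x hx => (huppos x hx).le
  have hdown' : ∀ x ∈ I, 0 ≤ udown x := fun x hx => (hdownpos x hx).le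
  have hz : (0 : ℝ) ∈ I := hI0 self_mem_Ici
  have hgup : ∀ x, 0 ≤ x → 0 ≤ gup x := fun x hx =>
    hup.deriv_nonneg hIopen hIconn hI0 hup' hupmono hx
  have hcont : ∀ {p : ℝ → ℝ}, ContinuousOn p I → ∀ x, 0 ≤ x → IntegrableOn p (Ioc 0 x) κ :=
    fun hp x hx => (hp.mono (hIconn.out hz (hI0 hx))).integrableOn_Ioc_of_measure_Icc_lt_top_s5
      (hκfin 0 hz x (hI0 hx))
  have hid := hcont continuousOn_id
  have hprod := hcont (hup.1.mul hdown.1)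
  rw [setLIntegral_Ioi_lt_top_iff (p := fun x => x) (fun t ht => ht.le)
      (fun x hx => hid x hx.le),
    setLIntegral_Ioi_lt_top_iff (p := fun x => uup x * udown x)
      (fun t ht => mul_nonneg (hup' t (hI0 (le_of_lt ht))) (hdown' t (hI0 (le_of_lt ht))))
      (fun x hx => hprod x hx.le)]
  tfae_have 1 → 3 :=
    hup.exists_le_mul_of_setIntegral_le hIopen hIconn hI0 hκfin huppos hupmono
  tfae_have 3 → 4 := by
    rintro ⟨C, -, hC⟩
    refine ⟨udown 0 * C, fun x hx => ?_⟩
    have h1 : ∫ t in Ioc 0 x, uup t * udown t ∂κ ≤ ∫ t in Ioc 0 x, udown 0 * uup t ∂κ := by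
      refine setIntegral_mono_on (hprod x hx.le)
        ((hup.integrableOn hIconn hκfin hz (hI0 hx.le)).const_mul _) measurableSet_Ioc
        fun t ht => ?_
      have ht0 := hI0 ht.1.le
      rw [mul_comm]
      exact mul_le_mul_of_nonneg_right (hdownanti hz ht0 ht.1.le) (hup' t ht0)
    rw [integral_const_mul] at h1
    refine h1.trans (mul_le_mul_of_nonneg_left ?_ (hdown' 0 hz))
    have h2 := hup.2.2.2 0 hz x (hI0 hx.le) hx.le
    have h3 := hup.deriv_le_of_le_mul hIconn hI0 hup' hC hx.le
    linarith [hgup 0 le_rfl]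
  tfae_have 4 → 2 :=
    hup.exists_tendsto_pos hdown hIconn hI0 hκfin huppos hupmono hgup hdownpos hdownanti
  tfae_have 2 → 1 := by
    rintro ⟨l, hl, hlim⟩
    have hle : ∀ x, 0 ≤ x → l ≤ udown x := fun x hx => le_of_tendsto hlim (by
      filter_upwards [eventually_ge_atTop x] with y hy
      exact hdownanti (hI0 hx) (hI0 (hx.trans hy)) hy)
    refine ⟨udown 0 / (2 * l), fun x hx => ?_⟩
    have h1 : ∫ t in Ioc 0 x, l * t ∂κ ≤ ∫ t in Ioc 0 x, t * udown t ∂κ := by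
      refine setIntegral_mono_on ((hid x hx.le).const_mul _)
        (hcont (continuousOn_id.mul hdown.1) x hx.le) measurableSet_Ioc fun t ht => ?_
      rw [mul_comm]
      exact mul_le_mul_of_nonneg_left (hle t ht.1.le) ht.1.le
    rw [integral_const_mul] at h1
    have h2 := hdown.setIntegral_id_mul hIconn hI0 hκfin hdown' hx.le
    have h3 := mul_nonneg hx.le
      (neg_nonneg.2 (hdown.deriv_nonpos hIconn hI0 hdown' hdownanti hx.le))
    have h4 := hdown' x (hI0 hx.le)
    rw [le_div_iff₀ (by positivity)]
    nlinarith
  tfae_finish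
end
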